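/- arXiv:2508.02108 — 3 statements merged into one kernel-verified Lean document; each statement's English description precedes it below -/
import Mathlib

section
/- For every 2-edge connected, 3-regular acyclic finite directed multigraph D on 2n vertices with a unique source and a unique sink, there exists a 2-edge connected, 3-regular acyclic finite directed multigraph D' on 2n vertices with a unique source and a unique sink such that D' contains a directed Hamiltonian path and the number of source-to-sink paths of D' is at least the number of source-to-sink paths of D. -/
/-- A finite directed multigraph with vertex set `Fin m` and edge set `Fin q`,
given by source and target maps. -/
structure Multigraph (m q : ℕ) where
  src : Fin q → Fin m
  tgt : Fin q → Fin m

namespace Multigraph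

variable {m q : ℕ}

/-- `p` is a directed path from `u` to `v`: a nonempty list of edges whose first edge
starts at `u`, whose last edge ends at `v`, and where consecutive edges are composable. -/
def IsPath (D : Multigraph m q) (u v : Fin m) (p : List (Fin q)) : Prop :=
  (∃ e rest, p = e :: rest ∧ D.src e = u) ∧
  (∃ e rest, p = rest ++ [e] ∧ D.tgt e = v) ∧
  p.Chain' (fun a b => D.tgt a = D.src b)

/-- The number of directed paths from `u` to `v` (paths counted as edge sequences). -/
noncomputable def pathCount (D : Multigraph m q) (u v : Fin m) : ℕ :=
  Nat.card {p : List (Fin q) // D.IsPath u v p}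

/-- `D` is acyclic: no vertex has a directed path to itself. -/
def Acyclic (D : Multigraph m q) : Prop :=
  ∀ v : Fin m, ¬ ∃ p, D.IsPath v v p

/-- In-degree of a vertex. -/
def indeg (D : Multigraph m q) (v : Fin m) : ℕ :=
  (Finset.univ.filter (fun e => D.tgt e = v)).card

/-- Out-degree of a vertex. -/
def outdeg (D : Multigraph m q) (v : Fin m) : ℕ :=
  (Finset.univ.filter (fun e => D.src e = v)).card

/-- `D` is 3-regular: every vertex has total degree 3. -/
def ThreeRegular (D : Multigraph m q) : Prop :=
  ∀ v : Fin m, D.indeg v + D.outdeg v = 3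

/-- `s` is the unique source (vertex of in-degree 0) of `D`. -/
def UniqueSource (D : Multigraph m q) (s : Fin m) : Prop :=
  D.indeg s = 0 ∧ ∀ v : Fin m, D.indeg v = 0 → v = s

/-- `t` is the unique sink (vertex of out-degree 0) of `D`. -/
def UniqueSink (D : Multigraph m q) (t : Fin m) : Prop :=
  D.outdeg t = 0 ∧ ∀ v : Fin m, D.outdeg v = 0 → v = t

/-- `μ_D(v)`: the number of directed paths from `s` to `v`, with `μ_D(s) = 1`. -/
noncomputable def mu (D : Multigraph m q) (s v : Fin m) : ℕ :=
  if v = s then 1 else D.pathCount s v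

/-- Two vertices are adjacent (disregarding orientation) via an edge in `S`. -/
def Adj (D : Multigraph m q) (S : Set (Fin q)) (a b : Fin m) : Prop :=
  ∃ e ∈ S, (D.src e = a ∧ D.tgt e = b) ∨ (D.src e = b ∧ D.tgt e = a)

/-- Weak connectivity using only the edges in `S`: any two distinct vertices are joined
by a finite sequence of edges of `S` traversed in either direction. -/
def WeaklyConnectedOn (D : Multigraph m q) (S : Set (Fin q)) : Prop :=
  ∀ a b : Fin m, a ≠ b → Relation.ReflTransGen (D.Adj S) a b

/-- `D` is weakly connected. -/
def WeaklyConnected (D : Multigraph m q) : Prop :=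
  D.WeaklyConnectedOn Set.univ

/-- `D` is `ℓ`-edge connected: it has at least two vertices, and deleting any set of at
most `ℓ - 1` edges leaves a weakly connected multigraph. -/
def EdgeConnected (D : Multigraph m q) (ℓ : ℕ) : Prop :=
  2 ≤ m ∧ ∀ F : Finset (Fin q), F.card ≤ ℓ - 1 → D.WeaklyConnectedOn {e | e ∉ F}

/-- `p` is a directed Hamiltonian path of `D` starting at `u`: a directed path that
visits every vertex exactly once. -/
def IsHamiltonianPath (D : Multigraph m q) (u : Fin m) (p : List (Fin q)) : Prop :=
  (∃ v, D.IsPath u v p) ∧ (u :: p.map D.tgt).Nodup ∧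
    ∀ w : Fin m, w ∈ u :: p.map D.tgt

/-- `D` contains a directed Hamiltonian path. -/
def HasHamiltonianPath (D : Multigraph m q) : Prop :=
  ∃ u p, D.IsHamiltonianPath u p

/-- `D` is simple: no two distinct edges have the same unordered pair of endpoints. -/
def Simple (D : Multigraph m q) : Prop :=
  ∀ e e' : Fin q, e ≠ e' →
    ¬ ((D.src e = D.src e' ∧ D.tgt e = D.tgt e') ∨
       (D.src e = D.tgt e' ∧ D.tgt e = D.src e'))

/-- `D` together with designated edges `H i` (from vertex `i` to vertex `i+1`, 0-based)
is a Hamiltonian-path digraph: the designated edges are pairwise distinct, form the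
Hamiltonian path, and every edge goes from a smaller vertex to a larger one.
(Vertices `0, …, m-1` here represent the vertices `1, …, m`.) -/
def IsHamPathDigraph (D : Multigraph m q) (H : Fin (m - 1) → Fin q) : Prop :=
  Function.Injective H ∧
  (∀ i : Fin (m - 1), (D.src (H i)).val = i.val ∧ (D.tgt (H i)).val = i.val + 1) ∧
  ∀ e : Fin q, (D.src e).val < (D.tgt e).val

end Multigraph

/-- The number of walks from `0` to `v` in the digraph on `ℕ` with edge maps `src`, `tgt`,
using only edges that increase the vertex. -/
def upCount {E : Type*} [Fintype E] (src tgt : E → ℕ) (v : ℕ) : ℕ :=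
  if v = 0 then 1
  else ∑ e, if _h : tgt e = v ∧ src e < v then upCount src tgt (src e) else 0
termination_by v
decreasing_by omega

/-- The number of walks from `v` to `m - 1` in the digraph on `ℕ` with edge maps `src`, `tgt`,
using only edges that increase the vertex and stay below `m`. -/
def downCount {E : Type*} [Fintype E] (m : ℕ) (src tgt : E → ℕ) (v : ℕ) : ℕ :=
  if m ≤ v + 1 then 1
  else ∑ e, if _h : src e = v ∧ v < tgt e ∧ tgt e < m then downCount m src tgt (tgt e) else 0
termination_by m - v
decreasing_by omega

/-- The vertices `0, …, m - 1` with the edge maps `src`, `tgt` form a 3-regular digraph whose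
edges increase, whose only source is `0`, whose only sink is `m - 1`, and in which at least two
edges leave every proper nonempty initial segment. -/
structure IsOrderedCubic {E : Type*} [Fintype E] (m : ℕ) (src tgt : E → ℕ) : Prop where
  lt : ∀ e, src e < tgt e
  tgt_lt : ∀ e, tgt e < m
  deg : ∀ v < m, (Finset.univ.filter fun e => tgt e = v).card +
    (Finset.univ.filter fun e => src e = v).card = 3
  exists_tgt : ∀ v < m, v ≠ 0 → ∃ e, tgt e = v
  exists_src : ∀ v, v + 1 < m → ∃ e, src e = v
  cut : ∀ k, k + 1 < m → 2 ≤ (Finset.univ.filter fun e => src e ≤ k ∧ k < tgt e).card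

section Counting

variable {E : Type*} [Fintype E] {m : ℕ} {src tgt : E → ℕ}

theorem upCount_zero : upCount src tgt 0 = 1 := by
  rw [upCount, if_pos rfl]

theorem upCount_eq_sum (hlt : ∀ e, src e < tgt e) {v : ℕ} (hv : v ≠ 0) :
    upCount src tgt v = ∑ e, if tgt e = v then upCount src tgt (src e) else 0 := by
  rw [upCount, if_neg hv]
  refine Finset.sum_congr rfl fun e _ => ?_
  by_cases h : tgt e = v
  · have h' : src e < v := h ▸ hlt e
    simp [h, h']
  · simp [h]

theorem downCount_of_le {v : ℕ} (hv : m ≤ v + 1) : downCount m src tgt v = 1 := by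
  rw [downCount, if_pos hv]

theorem downCount_eq_sum (hlt : ∀ e, src e < tgt e) (hm : ∀ e, tgt e < m) {v : ℕ}
    (hv : v + 1 < m) :
    downCount m src tgt v = ∑ e, if src e = v then downCount m src tgt (tgt e) else 0 := by
  rw [downCount, if_neg (by omega)]
  refine Finset.sum_congr rfl fun e _ => ?_
  by_cases h : src e = v
  · have h' : v < tgt e := h ▸ hlt e
    simp [h, h', hm e]
  · simp [h]

theorem upCount_congr {tgt' : E → ℕ} (hlt : ∀ e, src e < tgt e) (hlt' : ∀ e, src e < tgt' e)
    {k : ℕ} (h : ∀ e, ∀ v ≤ k, tgt' e = v ↔ tgt e = v) (v : ℕ) (hv : v ≤ k) :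
    upCount src tgt' v = upCount src tgt v := by
  induction v using Nat.strong_induction_on with
  | _ v ih =>
    rcases eq_or_ne v 0 with rfl | h0
    · rw [upCount_zero, upCount_zero]
    · rw [upCount_eq_sum hlt h0, upCount_eq_sum hlt' h0]
      refine Finset.sum_congr rfl fun e _ => ?_
      by_cases he : tgt e = v
      · have := hlt e
        rw [if_pos he, if_pos ((h e v hv).2 he), ih _ (by omega) (by omega)]
      · rw [if_neg he, if_neg (fun h' => he ((h e v hv).1 h'))]

theorem downCount_congr {tgt' : E → ℕ} (hlt : ∀ e, src e < tgt e) (hlt' : ∀ e, src e < tgt' e)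
    (hm : ∀ e, tgt e < m) (hm' : ∀ e, tgt' e < m)
    {k : ℕ} (h : ∀ e, k < src e → tgt' e = tgt e) (v : ℕ) (hv : k < v) :
    downCount m src tgt' v = downCount m src tgt v := by
  induction hd : m - v using Nat.strong_induction_on generalizing v with
  | _ d ih =>
    rcases le_or_gt m (v + 1) with h0 | h0
    · rw [downCount_of_le h0, downCount_of_le h0]
    · rw [downCount_eq_sum hlt hm h0, downCount_eq_sum hlt' hm' h0]
      refine Finset.sum_congr rfl fun e _ => ?_
      by_cases he : src e = v
      · have := hlt e
        have := hm e
        rw [if_pos he, if_pos he, h e (by omega), ih (m - tgt e) (by omega) _ (by omega) rfl]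
      · rw [if_neg he, if_neg he]

/-- Counting the walks from `0` to `m - 1` by the edge on which they leave `{0, …, k}`. -/
theorem sum_cut_eq (hlt : ∀ e, src e < tgt e) (hm : ∀ e, tgt e < m) {k : ℕ} (hk : k + 1 < m) :
    (∑ e, if src e ≤ k ∧ k < tgt e then upCount src tgt (src e) * downCount m src tgt (tgt e)
      else 0) = upCount src tgt (m - 1) := by
  induction hd : m - k using Nat.strong_induction_on generalizing k with
  | _ d ih =>
    rcases le_or_gt m (k + 2) with h0 | h0
    · have hkm : k + 1 = m - 1 := by omega
      rw [upCount_eq_sum hlt (by omega)]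
      refine Finset.sum_congr rfl fun e _ => ?_
      have h1 := hlt e
      have h2 := hm e
      by_cases he : tgt e = m - 1
      · rw [if_pos he, if_pos (by omega), he, downCount_of_le (by omega), mul_one]
      · rw [if_neg he, if_neg (by omega)]
    · rw [← ih (m - (k + 1)) (by omega) h0 rfl]
      have e1 : upCount src tgt (k + 1) * downCount m src tgt (k + 1) =
          ∑ e, if tgt e = k + 1 then
            upCount src tgt (src e) * downCount m src tgt (tgt e) else 0 := by
        rw [upCount_eq_sum hlt (by omega), Finset.sum_mul]
        refine Finset.sum_congr rfl fun e _ => ?_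
        split_ifs with h <;> simp [h]
      have e2 : upCount src tgt (k + 1) * downCount m src tgt (k + 1) =
          ∑ e, if src e = k + 1 then
            upCount src tgt (src e) * downCount m src tgt (tgt e) else 0 := by
        rw [downCount_eq_sum hlt hm h0, Finset.mul_sum]
        refine Finset.sum_congr rfl fun e _ => ?_
        split_ifs with h <;> simp [h]
      refine Nat.add_right_cancel (m := upCount src tgt (k + 1) * downCount m src tgt (k + 1)) ?_
      conv_lhs => rw [e2]
      conv_rhs => rw [e1]
      rw [← Finset.sum_add_distrib, ← Finset.sum_add_distrib]
      refine Finset.sum_congr rfl fun e _ => ?_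
      have h1 := hlt e
      split_ifs <;> omega

end Counting

namespace IsOrderedCubic

variable {E : Type*} [Fintype E] {m : ℕ} {src tgt : E → ℕ}

theorem upCount_pos (G : IsOrderedCubic m src tgt) (v : ℕ) (hv : v < m) :
    0 < upCount src tgt v := by
  induction v using Nat.strong_induction_on with
  | _ v ih =>
    rcases eq_or_ne v 0 with rfl | h0
    · rw [upCount_zero]; exact one_pos
    · obtain ⟨e, he⟩ := G.exists_tgt v hv h0
      have h1 := G.lt e
      rw [upCount_eq_sum G.lt h0]
      refine lt_of_lt_of_le (ih (src e) (by omega) (by omega))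
        (le_trans (le_of_eq (if_pos he).symm)
          (Finset.single_le_sum (f := fun e => if tgt e = v then upCount src tgt (src e) else 0)
            (fun _ _ => Nat.zero_le _) (Finset.mem_univ e)))

theorem downCount_pos (G : IsOrderedCubic m src tgt) (v : ℕ) (hv : v < m) :
    0 < downCount m src tgt v := by
  induction hd : m - v using Nat.strong_induction_on generalizing v with
  | _ d ih =>
    rcases le_or_gt m (v + 1) with h0 | h0
    · rw [downCount_of_le h0]; exact one_pos
    · obtain ⟨e, he⟩ := G.exists_src v h0
      have h1 := G.lt e
      have h2 := G.tgt_lt e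
      rw [downCount_eq_sum G.lt G.tgt_lt h0]
      refine lt_of_lt_of_le (ih (m - tgt e) (by omega) (tgt e) h2 rfl)
        (le_trans (le_of_eq (if_pos he).symm)
          (Finset.single_le_sum
            (f := fun e => if src e = v then downCount m src tgt (tgt e) else 0)
            (fun _ _ => Nat.zero_le _) (Finset.mem_univ e)))

theorem upCount_src_le (G : IsOrderedCubic m src tgt) (e : E) :
    upCount src tgt (src e) ≤ upCount src tgt (tgt e) := by
  have h1 := G.lt e
  rw [upCount_eq_sum G.lt (v := tgt e) (by omega)]
  exact le_trans (le_of_eq (if_pos rfl).symm)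
    (Finset.single_le_sum
      (f := fun f => if tgt f = tgt e then upCount src tgt (src f) else 0)
      (fun _ _ => Nat.zero_le _) (Finset.mem_univ e))

theorem downCount_tgt_le (G : IsOrderedCubic m src tgt) (e : E) :
    downCount m src tgt (tgt e) ≤ downCount m src tgt (src e) := by
  have h1 := G.lt e
  have h2 := G.tgt_lt e
  rw [downCount_eq_sum G.lt G.tgt_lt (v := src e) (by omega)]
  exact le_trans (le_of_eq (if_pos rfl).symm)
    (Finset.single_le_sum
      (f := fun f => if src f = src e then downCount m src tgt (tgt f) else 0)
      (fun _ _ => Nat.zero_le _) (Finset.mem_univ e))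

theorem upCount_src_lt [DecidableEq E] (G : IsOrderedCubic m src tgt) {e : E}
    (h : 1 < (Finset.univ.filter fun f => tgt f = tgt e).card) :
    upCount src tgt (src e) < upCount src tgt (tgt e) := by
  obtain ⟨f, hf, hfe⟩ := Finset.exists_mem_ne h e
  have hf' : tgt f = tgt e := by simpa using hf
  have h1 := G.lt e
  have h2 := G.lt f
  have h3 := G.upCount_pos (src f) (h2.trans (G.tgt_lt f))
  rw [upCount_eq_sum G.lt (v := tgt e) (by omega)]
  refine lt_of_lt_of_le ?_ (Finset.sum_le_sum_of_subset (Finset.subset_univ {e, f}))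
  rw [Finset.sum_pair hfe.symm, if_pos rfl, if_pos hf']
  omega

theorem downCount_tgt_lt [DecidableEq E] (G : IsOrderedCubic m src tgt) {e : E}
    (h : 1 < (Finset.univ.filter fun f => src f = src e).card) :
    downCount m src tgt (tgt e) < downCount m src tgt (src e) := by
  obtain ⟨f, hf, hfe⟩ := Finset.exists_mem_ne h e
  have hf' : src f = src e := by simpa using hf
  have h1 := G.lt e
  have h2 := G.tgt_lt e
  have h3 := G.downCount_pos (tgt f) (G.tgt_lt f)
  rw [downCount_eq_sum G.lt G.tgt_lt (v := src e) (by omega)]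
  refine lt_of_lt_of_le ?_ (Finset.sum_le_sum_of_subset (Finset.subset_univ {e, f}))
  rw [Finset.sum_pair hfe.symm, if_pos rfl, if_pos hf']
  omega

theorem upCount_src_eq (G : IsOrderedCubic m src tgt) {e : E}
    (h : (Finset.univ.filter fun f => tgt f = tgt e).card = 1) :
    upCount src tgt (tgt e) = upCount src tgt (src e) := by
  have h1 := G.lt e
  obtain ⟨a, ha⟩ := Finset.card_eq_one.1 h
  have hae : e = a := by
    rw [← Finset.mem_singleton, ← ha]; simp
  rw [upCount_eq_sum G.lt (v := tgt e) (by omega), ← Finset.sum_filter, ha, hae,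
    Finset.sum_singleton]

theorem downCount_tgt_eq (G : IsOrderedCubic m src tgt) {e : E}
    (h : (Finset.univ.filter fun f => src f = src e).card = 1) :
    downCount m src tgt (src e) = downCount m src tgt (tgt e) := by
  have h1 := G.lt e
  have h2 := G.tgt_lt e
  obtain ⟨a, ha⟩ := Finset.card_eq_one.1 h
  have hae : e = a := by
    rw [← Finset.mem_singleton, ← ha]; simp
  rw [downCount_eq_sum G.lt G.tgt_lt (v := src e) (by omega), ← Finset.sum_filter, ha, hae,
    Finset.sum_singleton]

end IsOrderedCubic

namespace IsOrderedCubic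

variable {E : Type*} [Fintype E] [DecidableEq E] {m : ℕ} {src tgt : E → ℕ}

/-- Exchanging the targets of two edges that leave a common initial segment. -/
theorem swap_tgt (G : IsOrderedCubic m src tgt) {k : ℕ} {e f : E}
    (he : src e ≤ k) (he' : k < tgt e) (hf : src f ≤ k) (hf' : k < tgt f) :
    IsOrderedCubic m src (tgt ∘ Equiv.swap e f) := by
  have hlt : ∀ x, src x < (tgt ∘ Equiv.swap e f) x := by
    intro x
    have := G.lt x
    simp only [Function.comp_apply, Equiv.swap_apply_def]
    split_ifs with h1 h2
    · subst h1; omega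
    · subst h2; omega
    · exact this
  have hcard : ∀ p : ℕ → Prop, ∀ [DecidablePred p],
      (Finset.univ.filter fun x => p ((tgt ∘ Equiv.swap e f) x)).card =
        (Finset.univ.filter fun x => p (tgt x)).card := fun p _ =>
    Finset.card_equiv (Equiv.swap e f) (fun x => by simp)
  have hcut : ∀ t : E → ℕ, (∀ x, src x < t x) → ∀ j,
      (Finset.univ.filter fun x => src x ≤ j ∧ j < t x).card +
        (Finset.univ.filter fun x => t x ≤ j).card =
          (Finset.univ.filter fun x => src x ≤ j).card := by
    intro t ht j
    rw [← Finset.card_union_of_disjoint]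
    · congr 1
      ext x
      have := ht x
      simp only [Finset.mem_union, Finset.mem_filter, Finset.mem_univ, true_and]
      omega
    · refine Finset.disjoint_filter.2 fun x _ h1 h2 => ?_
      omega
  refine ⟨hlt, fun x => G.tgt_lt _, fun v hv => ?_, fun v hv h0 => ?_, G.exists_src,
    fun j hj => ?_⟩
  · rw [hcard (fun w => w = v)]
    exact G.deg v hv
  · obtain ⟨x, hx⟩ := G.exists_tgt v hv h0
    exact ⟨Equiv.swap e f x, by simp [hx]⟩
  · have h1 := hcut _ hlt j
    have h2 := hcut _ G.lt j
    have h3 := hcard (fun w => w ≤ j)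
    have h4 := G.cut j hj
    omega

theorem upCount_swap_tgt (G : IsOrderedCubic m src tgt) {k : ℕ} {e f : E}
    (he : src e ≤ k) (he' : k < tgt e) (hf : src f ≤ k) (hf' : k < tgt f) {v : ℕ} (hv : v ≤ k) :
    upCount src (tgt ∘ Equiv.swap e f) v = upCount src tgt v := by
  refine upCount_congr G.lt (G.swap_tgt he he' hf hf').lt (fun x w hw => ?_) v hv
  simp only [Function.comp_apply, Equiv.swap_apply_def]
  split_ifs with h1 h2
  · subst h1; omega
  · subst h2; omega
  · rfl

theorem downCount_swap_tgt (G : IsOrderedCubic m src tgt) {k : ℕ} {e f : E}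
    (he : src e ≤ k) (he' : k < tgt e) (hf : src f ≤ k) (hf' : k < tgt f) {v : ℕ} (hv : k < v) :
    downCount m src (tgt ∘ Equiv.swap e f) v = downCount m src tgt v := by
  have G' := G.swap_tgt he he' hf hf'
  refine downCount_congr G.lt G'.lt G.tgt_lt G'.tgt_lt (fun x hx => ?_) v hv
  have h1 : x ≠ e := by rintro rfl; omega
  have h2 : x ≠ f := by rintro rfl; omega
  simp [Equiv.swap_apply_of_ne_of_ne h1 h2]

/-- The effect on the number of source-to-sink walks of exchanging the targets of two edges that
leave a common initial segment. -/
theorem upCount_last_swap_tgt (G : IsOrderedCubic m src tgt) {k : ℕ} {e f : E}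
    (he : src e ≤ k) (he' : k < tgt e) (hf : src f ≤ k) (hf' : k < tgt f) :
    (upCount src (tgt ∘ Equiv.swap e f) (m - 1) : ℤ) = upCount src tgt (m - 1) +
      ((upCount src tgt (src e) : ℤ) - upCount src tgt (src f)) *
        ((downCount m src tgt (tgt f) : ℤ) - downCount m src tgt (tgt e)) := by
  rcases eq_or_ne e f with rfl | hne
  · simp
  have G' := G.swap_tgt he he' hf hf'
  have hk : k + 1 < m := lt_of_le_of_lt he' (G.tgt_lt e)
  rw [← sub_eq_iff_eq_add', ← sum_cut_eq G.lt G.tgt_lt hk, ← sum_cut_eq G'.lt G'.tgt_lt hk]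
  push_cast
  rw [← Finset.sum_sub_distrib, Fintype.sum_eq_add e f hne]
  · have hue := G.upCount_swap_tgt he he' hf hf' he
    have huf := G.upCount_swap_tgt he he' hf hf' hf
    have hde := G.downCount_swap_tgt he he' hf hf' he'
    have hdf := G.downCount_swap_tgt he he' hf hf' hf'
    simp only [Function.comp_apply, Equiv.swap_apply_left, Equiv.swap_apply_right,
      he, he', hf, hf', and_self, if_true]
    rw [hue, huf, hde, hdf]
    ring
  · rintro x ⟨h1, h2⟩
    simp only [Function.comp_apply, Equiv.swap_apply_of_ne_of_ne h1 h2]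
    split_ifs with h
    · rw [G.upCount_swap_tgt he he' hf hf' h.1, G.downCount_swap_tgt he he' hf hf' h.2, sub_self]
    · simp

/-- A consecutive pair of nonadjacent vertices `p`, `p + 1` can be rewired so that both lie on a
common walk; this is the resulting change in the number of source-to-sink walks. -/
theorem exists_rewire (G : IsOrderedCubic m src tgt) {p : ℕ} {a x y : E}
    (hadj : ∀ e, src e = p → tgt e ≠ p + 1)
    (ha : tgt a = p + 1) (hx : src x = p + 1) (hy : src y = p) :
    ∃ tgt' : E → ℕ, IsOrderedCubic m src tgt' ∧
      (upCount src tgt' (m - 1) : ℤ) = upCount src tgt (m - 1) +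
        (((upCount src tgt (p + 1) : ℤ) - upCount src tgt (src a)) *
          ((downCount m src tgt (tgt y) : ℤ) - downCount m src tgt (tgt x)) +
        ((downCount m src tgt (p + 1) : ℤ) - downCount m src tgt (tgt x)) *
          ((upCount src tgt p : ℤ) - upCount src tgt (src a))) := by
  have ha1 := G.lt a
  have hx1 := G.lt x
  have hy1 := G.lt y
  have hy2 := hadj y hy
  have hay : a ≠ y := by rintro rfl; omega
  have hax : a ≠ x := by rintro rfl; omega
  have hxy : x ≠ y := by rintro rfl; omega
  have h1 : src a ≤ p := by omega
  have h2 : p < tgt a := by omega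
  have h3 : src y ≤ p := by omega
  have h4 : p < tgt y := by omega
  have G₁ := G.swap_tgt h1 h2 h3 h4
  have t₁ := G.upCount_last_swap_tgt h1 h2 h3 h4
  have u₁ : upCount src (tgt ∘ Equiv.swap a y) (src a) = upCount src tgt (src a) :=
    G.upCount_swap_tgt h1 h2 h3 h4 h1
  have d₁ : ∀ v, p < v → downCount m src (tgt ∘ Equiv.swap a y) v = downCount m src tgt v :=
    fun v hv => G.downCount_swap_tgt h1 h2 h3 h4 hv
  have v₁ : (upCount src (tgt ∘ Equiv.swap a y) (p + 1) : ℤ) =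
      upCount src tgt (p + 1) - upCount src tgt (src a) + upCount src tgt p := by
    rw [sub_add_eq_add_sub, add_sub_assoc, ← sub_eq_iff_eq_add', upCount_eq_sum G₁.lt (by omega),
      upCount_eq_sum G.lt (by omega)]
    push_cast
    rw [← Finset.sum_sub_distrib, Fintype.sum_eq_add a y hay]
    · simp only [Function.comp_apply, Equiv.swap_apply_left, Equiv.swap_apply_right, ha, hy, hy2,
        if_true, if_false, G.upCount_swap_tgt h1 h2 h3 h4 h1,
        G.upCount_swap_tgt h1 h2 h3 h4 le_rfl]
      ring
    · rintro z ⟨hz1, hz2⟩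
      have := G.lt z
      simp only [Function.comp_apply, Equiv.swap_apply_of_ne_of_ne hz1 hz2]
      split_ifs with h
      · rw [G.upCount_swap_tgt h1 h2 h3 h4 (by omega), sub_self]
      · simp
  have m₁ : (tgt ∘ Equiv.swap a y) a = tgt y := by simp
  have m₂ : (tgt ∘ Equiv.swap a y) x = tgt x := by
    simp [Equiv.swap_apply_of_ne_of_ne hax.symm hxy]
  have k1 : src a ≤ p + 1 := by omega
  have k2 : p + 1 < (tgt ∘ Equiv.swap a y) a := by omega
  have k3 : src x ≤ p + 1 := by omega
  have k4 : p + 1 < (tgt ∘ Equiv.swap a y) x := by omega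
  refine ⟨_, G₁.swap_tgt k1 k2 k3 k4, ?_⟩
  rw [G₁.upCount_last_swap_tgt k1 k2 k3 k4, t₁, m₁, m₂, u₁, d₁ _ h4, d₁ _ (by omega), hx, v₁,
    ha, hy]
  ring

end IsOrderedCubic

namespace IsOrderedCubic

variable {E : Type*} [Fintype E] {m : ℕ} {src tgt : E → ℕ}

/-- Exchanging two consecutive nonadjacent vertices in the linear order. -/
theorem relabel (G : IsOrderedCubic m src tgt) {i : ℕ} (hi : 1 ≤ i) (him : i + 2 < m)
    (hadj : ∀ e, src e = i → tgt e ≠ i + 1) :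
    IsOrderedCubic m (Equiv.swap i (i + 1) ∘ src) (Equiv.swap i (i + 1) ∘ tgt) := by
  have hval : ∀ v, Equiv.swap i (i + 1) v = if v = i then i + 1 else if v = i + 1 then i else v :=
    Equiv.swap_apply_def i (i + 1)
  have hlt : ∀ v, v < m → Equiv.swap i (i + 1) v < m := by
    intro v hv
    rw [hval]; split_ifs <;> omega
  refine ⟨fun e => ?_, fun e => hlt _ (G.tgt_lt e), fun v hv => ?_, fun v hv h0 => ?_,
    fun v hv => ?_, fun k hk => ?_⟩
  · have h1 := G.lt e
    have h2 := hadj e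
    simp only [Function.comp_apply, hval]
    split_ifs <;> omega
  · have := G.deg _ (hlt v hv)
    simpa only [Function.comp_apply, Equiv.swap_apply_eq_iff] using this
  · obtain ⟨e, he⟩ := G.exists_tgt _ (hlt v hv) (by rw [hval]; split_ifs <;> omega)
    exact ⟨e, by simp [he]⟩
  · obtain ⟨e, he⟩ := G.exists_src (Equiv.swap i (i + 1) v) (by rw [hval]; split_ifs <;> omega)
    exact ⟨e, by simp [he]⟩
  · rcases eq_or_ne k i with rfl | hki
    · obtain ⟨e, he⟩ := G.exists_tgt k (by omega) (by omega)
      obtain ⟨f, hf⟩ := G.exists_src (k + 1) (by omega)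
      have h1 := G.lt e
      have h2 := G.lt f
      refine Finset.one_lt_card.2 ⟨e, ?_, f, ?_, ?_⟩
      · simp only [Finset.mem_filter, Finset.mem_univ, true_and, Function.comp_apply, hval]
        split_ifs <;> omega
      · simp only [Finset.mem_filter, Finset.mem_univ, true_and, Function.comp_apply, hval]
        split_ifs <;> omega
      · rintro rfl; omega
    · refine (G.cut k hk).trans_eq (congrArg Finset.card (Finset.filter_congr fun e _ => ?_))
      simp only [Function.comp_apply, hval]
      split_ifs <;> omega

theorem upCount_relabel (G : IsOrderedCubic m src tgt) {i : ℕ} (hi : 1 ≤ i) (him : i + 2 < m)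
    (hadj : ∀ e, src e = i → tgt e ≠ i + 1) (v : ℕ) :
    upCount (Equiv.swap i (i + 1) ∘ src) (Equiv.swap i (i + 1) ∘ tgt) v =
      upCount src tgt (Equiv.swap i (i + 1) v) := by
  have G' := G.relabel hi him hadj
  induction v using Nat.strong_induction_on with
  | _ v ih =>
    rcases eq_or_ne v 0 with rfl | h0
    · rw [Equiv.swap_apply_of_ne_of_ne (by omega) (by omega), upCount_zero, upCount_zero]
    · have h0' : Equiv.swap i (i + 1) v ≠ 0 := by
        rw [Equiv.swap_apply_def]; split_ifs <;> omega
      rw [upCount_eq_sum G'.lt h0, upCount_eq_sum G.lt h0']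
      refine Finset.sum_congr rfl fun e _ => ?_
      simp only [Function.comp_apply, Equiv.swap_apply_eq_iff]
      split_ifs with h
      · have := G'.lt e
        simp only [Function.comp_apply, h, Equiv.swap_apply_self] at this
        simpa using ih _ this
      · rfl

theorem downCount_relabel (G : IsOrderedCubic m src tgt) {i : ℕ} (hi : 1 ≤ i) (him : i + 2 < m)
    (hadj : ∀ e, src e = i → tgt e ≠ i + 1) (v : ℕ) :
    downCount m (Equiv.swap i (i + 1) ∘ src) (Equiv.swap i (i + 1) ∘ tgt) v =
      downCount m src tgt (Equiv.swap i (i + 1) v) := by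
  have G' := G.relabel hi him hadj
  induction hd : m - v using Nat.strong_induction_on generalizing v with
  | _ d ih =>
    rcases le_or_gt m (v + 1) with h0 | h0
    · rw [Equiv.swap_apply_of_ne_of_ne (by omega) (by omega), downCount_of_le h0,
        downCount_of_le h0]
    · have h0' : Equiv.swap i (i + 1) v + 1 < m := by
        rw [Equiv.swap_apply_def]; split_ifs <;> omega
      rw [downCount_eq_sum G'.lt G'.tgt_lt h0, downCount_eq_sum G.lt G.tgt_lt h0']
      refine Finset.sum_congr rfl fun e _ => ?_
      simp only [Function.comp_apply, Equiv.swap_apply_eq_iff]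
      split_ifs with h
      · have h1 := G'.lt e
        have h2 := G'.tgt_lt e
        simp only [Function.comp_apply, h, Equiv.swap_apply_self] at h1 h2
        simpa using ih (m - Equiv.swap i (i + 1) (tgt e)) (by omega) _ rfl
      · rfl

end IsOrderedCubic

/-- A digraph as in `IsOrderedCubic` that maximizes the number of source-to-sink walks and, among
these, minimizes the sum of the sources of all edges. -/
structure IsOptimal {E : Type*} [Fintype E] (m : ℕ) (src tgt : E → ℕ) : Prop extends
    IsOrderedCubic m src tgt where
  max : ∀ src' tgt' : E → ℕ, IsOrderedCubic m src' tgt' →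
    upCount src' tgt' (m - 1) ≤ upCount src tgt (m - 1)
  min : ∀ src' tgt' : E → ℕ, IsOrderedCubic m src' tgt' →
    upCount src' tgt' (m - 1) = upCount src tgt (m - 1) → ∑ e, src e ≤ ∑ e, src' e

theorem IsOrderedCubic.exists_isOptimal {E : Type*} [Fintype E] {m : ℕ} {src tgt : E → ℕ}
    (G : IsOrderedCubic m src tgt) :
    ∃ src' tgt' : E → ℕ, IsOptimal m src' tgt' := by
  have hfin : {H : (E → ℕ) × (E → ℕ) | IsOrderedCubic m H.1 H.2}.Finite := by
    have h : {f : E → ℕ | ∀ e, f e < m}.Finite := Set.Finite.pi' fun _ => Set.finite_lt_nat m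
    exact (h.prod h).subset fun H hH =>
      ⟨fun e => (hH.lt e).trans (hH.tgt_lt e), fun e => hH.tgt_lt e⟩
  obtain ⟨A, hA, hmax⟩ := Set.exists_max_image _
    (fun H : (E → ℕ) × (E → ℕ) => upCount H.1 H.2 (m - 1)) hfin ⟨(src, tgt), G⟩
  obtain ⟨B, ⟨hB, hBA⟩, hmin⟩ := Set.exists_min_image
    {H : (E → ℕ) × (E → ℕ) | IsOrderedCubic m H.1 H.2 ∧
      upCount H.1 H.2 (m - 1) = upCount A.1 A.2 (m - 1)}
    (fun H => ∑ e, H.1 e) (hfin.subset fun H hH => hH.1) ⟨A, hA, rfl⟩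
  exact ⟨B.1, B.2, hB, fun s t h => hBA ▸ hmax (s, t) h,
    fun s t h h' => hmin (s, t) ⟨h, h'.trans hBA⟩⟩

namespace IsOptimal

variable {E : Type*} [Fintype E] {m : ℕ} {src tgt : E → ℕ}

theorem card_src_succ_le (G : IsOptimal m src tgt) {i : ℕ}
    (hi : 1 ≤ i) (him : i + 2 < m) (hadj : ∀ e, src e = i → tgt e ≠ i + 1) :
    (Finset.univ.filter fun e => src e = i + 1).card ≤
      (Finset.univ.filter fun e => src e = i).card := by
  have h := G.min _ _ (G.relabel hi him hadj) (by
    rw [G.upCount_relabel hi him hadj, Equiv.swap_apply_of_ne_of_ne (by omega) (by omega)])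
  have h' : ∑ e, (Equiv.swap i (i + 1) ∘ src) e +
      (Finset.univ.filter fun e => src e = i + 1).card =
        ∑ e, src e + (Finset.univ.filter fun e => src e = i).card := by
    simp only [Finset.card_filter, ← Finset.sum_add_distrib, Function.comp_apply,
      Equiv.swap_apply_def]
    refine Finset.sum_congr rfl fun e _ => ?_
    split_ifs <;> omega
  omega

variable [DecidableEq E]

theorem rewire_nonpos (G : IsOptimal m src tgt) {p : ℕ} {a x y : E}
    (hadj : ∀ e, src e = p → tgt e ≠ p + 1)
    (ha : tgt a = p + 1) (hx : src x = p + 1) (hy : src y = p) :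
    ((upCount src tgt (p + 1) : ℤ) - upCount src tgt (src a)) *
          ((downCount m src tgt (tgt y) : ℤ) - downCount m src tgt (tgt x)) +
        ((downCount m src tgt (p + 1) : ℤ) - downCount m src tgt (tgt x)) *
          ((upCount src tgt p : ℤ) - upCount src tgt (src a)) ≤ 0 := by
  obtain ⟨tgt', G', h⟩ := G.exists_rewire hadj ha hx hy
  have := G.max _ _ G'
  omega

theorem rewire_relabel_nonpos (G : IsOptimal m src tgt) {i : ℕ} {a x y : E}
    (hi : 1 ≤ i) (him : i + 2 < m) (hadj : ∀ e, src e = i → tgt e ≠ i + 1)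
    (ha : tgt a = i) (hx : src x = i) (hy : src y = i + 1) :
    ((upCount src tgt i : ℤ) - upCount src tgt (src a)) *
          ((downCount m src tgt (tgt y) : ℤ) - downCount m src tgt (tgt x)) +
        ((downCount m src tgt i : ℤ) - downCount m src tgt (tgt x)) *
          ((upCount src tgt (i + 1) : ℤ) - upCount src tgt (src a)) ≤ 0 := by
  have hadj' : ∀ e, (Equiv.swap i (i + 1) ∘ src) e = i →
      (Equiv.swap i (i + 1) ∘ tgt) e ≠ i + 1 := by
    intro e h1 h2
    have := G.lt e
    simp only [Function.comp_apply, Equiv.swap_apply_eq_iff, Equiv.swap_apply_left,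
      Equiv.swap_apply_right] at h1 h2
    omega
  obtain ⟨tgt', G', h⟩ := (G.relabel hi him hadj).exists_rewire (a := a) (x := x) (y := y) hadj'
    (by simp [ha]) (by simp [hx]) (by simp [hy])
  have hmax := G.max _ _ G'
  simp only [G.upCount_relabel hi him hadj, G.downCount_relabel hi him hadj, Function.comp_apply,
    Equiv.swap_apply_self, Equiv.swap_apply_left, Equiv.swap_apply_right,
    Equiv.swap_apply_of_ne_of_ne (show m - 1 ≠ i by omega) (show m - 1 ≠ i + 1 by omega)] at h
  omega

/-- In an optimal digraph, consecutive nonadjacent vertices can be made adjacent by exchanging the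
targets of two edges, without changing the number of source-to-sink walks. -/
theorem exists_swap_eq (G : IsOptimal m src tgt) {i : ℕ}
    (hi : 1 ≤ i) (him : i + 2 < m) (hadj : ∀ e, src e = i → tgt e ≠ i + 1) :
    ∃ b x, tgt b = i + 1 ∧ src x = i ∧
      ((upCount src tgt (src b) : ℤ) - upCount src tgt (src x)) *
        ((downCount m src tgt (tgt x) : ℤ) - downCount m src tgt (tgt b)) = 0 := by
  by_contra! hne
  obtain ⟨a, ha⟩ := G.exists_tgt i (by omega) (by omega)
  obtain ⟨b, hb⟩ := G.exists_tgt (i + 1) (by omega) (by omega)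
  obtain ⟨x, hx⟩ := G.exists_src i (by omega)
  obtain ⟨y, hy⟩ := G.exists_src (i + 1) (by omega)
  have hb1 := G.lt b
  have hx1 := G.lt x
  have hx2 := hadj x hx
  have hbi : src b ≤ i := by omega
  have hbi' : i < tgt b := by omega
  have hneg : ((upCount src tgt (src b) : ℤ) - upCount src tgt (src x)) *
      ((downCount m src tgt (tgt x) : ℤ) - downCount m src tgt (tgt b)) < 0 := by
    refine lt_of_le_of_ne ?_ (hne b x hb hx)
    have h1 := G.upCount_last_swap_tgt hbi hbi' hx.le (by omega : i < tgt x)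
    have h2 := G.max _ _ (G.swap_tgt hbi hbi' hx.le (by omega : i < tgt x))
    omega
  have hK := G.rewire_nonpos hadj hb hy hx
  have hK' := G.rewire_relabel_nonpos hi him hadj ha hx hy
  have hms := G.card_src_succ_le hi him hadj
  have hdeg := G.deg i (by omega)
  have hdeg' := G.deg (i + 1) (by omega)
  have ha_le := G.upCount_src_le a
  have hb_le := G.upCount_src_le b
  have hx_le := G.downCount_tgt_le x
  have hy_le := G.downCount_tgt_le y
  have ha_pos : 0 < (Finset.univ.filter fun e => tgt e = i).card :=
    Finset.card_pos.2 ⟨a, by simp [ha]⟩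
  have hb_pos : 0 < (Finset.univ.filter fun e => tgt e = i + 1).card :=
    Finset.card_pos.2 ⟨b, by simp [hb]⟩
  have hx_pos : 0 < (Finset.univ.filter fun e => src e = i).card :=
    Finset.card_pos.2 ⟨x, by simp [hx]⟩
  have hy_pos : 0 < (Finset.univ.filter fun e => src e = i + 1).card :=
    Finset.card_pos.2 ⟨y, by simp [hy]⟩
  have ha_lt := G.upCount_src_lt (e := a)
  have hb_lt := G.upCount_src_lt (e := b)
  have hx_lt := G.downCount_tgt_lt (e := x)
  have hy_lt := G.downCount_tgt_lt (e := y)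
  have ha_eq := G.upCount_src_eq (e := a)
  have hx_eq := G.downCount_tgt_eq (e := x)
  have hy_eq := G.downCount_tgt_eq (e := y)
  rw [ha] at ha_le ha_lt ha_eq
  rw [hb] at hb_le hb_lt hneg
  rw [hx] at hx_le hx_lt hx_eq hneg
  rw [hy] at hy_le hy_lt hy_eq
  zify at ha_le hb_le hx_le hy_le
  rcases mul_neg_iff.1 hneg with ⟨h1, h2⟩ | ⟨h1, h2⟩
  · have h5 : (0 : ℤ) < upCount src tgt (i + 1) - upCount src tgt (src a) := by linarith
    rcases (show (Finset.univ.filter fun e => src e = i).card = 2 ∨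
      (Finset.univ.filter fun e => src e = i).card = 1 by omega) with h | h
    · have h3 := hx_lt (by omega)
      zify at h3
      rw [ha_eq (by omega), sub_self, zero_mul, zero_add] at hK'
      exact hK'.not_gt (mul_pos (sub_pos.2 h3) h5)
    · have h3 := ha_lt (by omega)
      zify at h3
      rw [hx_eq h, sub_self, zero_mul, add_zero] at hK'
      rw [hy_eq (by omega)] at h2
      exact hK'.not_gt (mul_pos (sub_pos.2 h3) (by linarith))
  · have h4 : (0 : ℤ) < downCount m src tgt (tgt x) - downCount m src tgt (tgt y) := by linarith
    have h5 : (0 : ℤ) < upCount src tgt i - upCount src tgt (src b) := by linarith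
    rcases (show (Finset.univ.filter fun e => tgt e = i + 1).card = 2 ∨
      (Finset.univ.filter fun e => src e = i + 1).card = 2 by omega) with h | h
    · have h3 := hb_lt (by omega)
      zify at h3
      exact hK.not_gt (add_pos_of_pos_of_nonneg (mul_pos (sub_pos.2 h3) h4)
        (mul_nonneg (sub_nonneg.2 hy_le) h5.le))
    · have h3 := hy_lt (by omega)
      zify at h3
      exact hK.not_gt (add_pos_of_nonneg_of_pos (mul_nonneg (sub_nonneg.2 hb_le) h4.le)
        (mul_pos (sub_pos.2 h3) h5))

theorem exists_adjacent_below (G : IsOptimal m src tgt) (k : ℕ) :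
    ∃ src' tgt' : E → ℕ, IsOptimal m src' tgt' ∧
      ∀ j < k, j + 1 < m → ∃ e, src' e = j ∧ tgt' e = j + 1 := by
  induction k with
  | zero => exact ⟨src, tgt, G, by simp⟩
  | succ k ih =>
    obtain ⟨s, t, H, hH⟩ := ih
    by_cases hk : k + 1 < m → ∃ e, s e = k ∧ t e = k + 1
    · refine ⟨s, t, H, fun j hj hjm => ?_⟩
      rcases Nat.lt_succ_iff_lt_or_eq.1 hj with h | rfl
      · exact hH j h hjm
      · exact hk hjm
    · push Not at hk
      obtain ⟨hkm, hadj⟩ := hk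
      have hk1 : 1 ≤ k := by
        by_contra! h0
        obtain ⟨e, he⟩ := H.exists_tgt (k + 1) hkm (by omega)
        have := H.lt e
        exact hadj e (by omega) he
      have hk2 : k + 2 < m := by
        by_contra! h0
        obtain ⟨e, he⟩ := H.exists_src k hkm
        have h1 := H.lt e
        have h2 := H.tgt_lt e
        exact hadj e he (by omega)
      obtain ⟨b, x, hb, hx, h0⟩ := H.exists_swap_eq hk1 hk2 hadj
      have hb1 := H.lt b
      have hx1 := H.lt x
      have hb2 : s b ≤ k := by omega
      have hb3 : k < t b := by omega
      have hx3 : k < t x := by omega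
      have hT := H.upCount_last_swap_tgt hb2 hb3 hx.le hx3
      rw [h0, add_zero, Nat.cast_inj] at hT
      refine ⟨s, t ∘ Equiv.swap b x, ⟨H.swap_tgt hb2 hb3 hx.le hx3, fun s' t' h => ?_,
        fun s' t' h h' => ?_⟩, fun j hj hjm => ?_⟩
      · rw [hT]
        exact H.max s' t' h
      · rw [hT] at h'
        exact H.min s' t' h h'
      · rcases Nat.lt_succ_iff_lt_or_eq.1 hj with h | rfl
        · obtain ⟨e, he, he'⟩ := hH j h hjm
          refine ⟨e, he, ?_⟩
          rw [Function.comp_apply, Equiv.swap_apply_of_ne_of_ne, he']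
          · rintro rfl; omega
          · rintro rfl; omega
        · exact ⟨x, hx, by simp [hb]⟩

end IsOptimal

theorem IsOrderedCubic.exists_adjacent {E : Type*} [Fintype E] {m : ℕ} {src tgt : E → ℕ}
    (G : IsOrderedCubic m src tgt) :
    ∃ src' tgt' : E → ℕ, IsOrderedCubic m src' tgt' ∧
      upCount src tgt (m - 1) ≤ upCount src' tgt' (m - 1) ∧
      ∀ j, j + 1 < m → ∃ e, src' e = j ∧ tgt' e = j + 1 := by
  classical
  obtain ⟨s, t, H⟩ := G.exists_isOptimal
  obtain ⟨s', t', H', h⟩ := H.exists_adjacent_below m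
  exact ⟨s', t', H'.toIsOrderedCubic, H'.max _ _ G, fun j hj => h j (by omega) hj⟩

namespace Multigraph

variable {m q : ℕ}

theorem isPath_append_singleton_iff (D : Multigraph m q) {u v : Fin m} {p : List (Fin q)}
    {e : Fin q} :
    D.IsPath u v (p ++ [e]) ↔
      D.tgt e = v ∧ (p = [] ∧ D.src e = u ∨ D.IsPath u (D.src e) p) := by
  have hlast : (∃ f rest, p ++ [e] = rest ++ [f] ∧ D.tgt f = v) ↔ D.tgt e = v := by
    constructor
    · rintro ⟨f, rest, h, rfl⟩
      rw [(List.append_singleton_inj.1 h).2]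
    · exact fun h => ⟨e, p, rfl, h⟩
  unfold IsPath
  rw [hlast]
  rcases List.eq_nil_or_concat p with rfl | ⟨r, f, rfl⟩
  · simp [List.Chain', and_comm]
  · have hhead : (∃ g rest, (r ++ [f]) ++ [e] = g :: rest ∧ D.src g = u) ↔
        ∃ g rest, r ++ [f] = g :: rest ∧ D.src g = u := by
      cases r <;> simp
    have hlast' : (∃ g rest, r ++ [f] = rest ++ [g] ∧ D.tgt g = D.src e) ↔
        D.tgt f = D.src e := by
      constructor
      · rintro ⟨g, rest, h, h'⟩
        rw [(List.append_singleton_inj.1 h).2, h']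
      · exact fun h => ⟨f, r, rfl, h⟩
    simp only [List.concat_eq_append] at *
    rw [hhead, hlast', List.Chain', List.Chain', List.isChain_append (l₁ := r ++ [f])]
    simp
    tauto

theorem IsPath.ne_nil {D : Multigraph m q} {u v : Fin m} {p : List (Fin q)}
    (h : D.IsPath u v p) : p ≠ [] := by
  obtain ⟨⟨e, r, rfl, -⟩, -⟩ := h
  simp

theorem IsPath.lt {D : Multigraph m q} {σ : Fin m → ℕ} (hσ : ∀ e, σ (D.src e) < σ (D.tgt e))
    {u : Fin m} (p : List (Fin q)) {v : Fin m} (h : D.IsPath u v p) : σ u < σ v := by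
  induction p using List.reverseRecOn generalizing v with
  | nil => exact absurd rfl h.ne_nil
  | append_singleton p e ih =>
    obtain ⟨rfl, ⟨-, rfl⟩ | h'⟩ := (D.isPath_append_singleton_iff).1 h
    · exact hσ e
    · exact (ih h').trans (hσ e)

theorem acyclic_of_lt {D : Multigraph m q} {σ : Fin m → ℕ}
    (hσ : ∀ e, σ (D.src e) < σ (D.tgt e)) : D.Acyclic :=
  fun _ ⟨p, hp⟩ => lt_irrefl _ (IsPath.lt hσ p hp)

theorem mu_eq_upCount {D : Multigraph m q} {σ : Fin m → ℕ} (hinj : Function.Injective σ)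
    (hσ : ∀ e, σ (D.src e) < σ (D.tgt e)) {s : Fin m} (hs : σ s = 0) (v : Fin m) :
    D.mu s v = upCount (σ ∘ D.src) (σ ∘ D.tgt) (σ v) := by
  have key : ∀ n v, σ v = n → ∃ F : Finset (List (Fin q)),
      (∀ p, p ∈ F ↔ (p = [] ∧ v = s ∨ D.IsPath s v p)) ∧
        F.card = upCount (σ ∘ D.src) (σ ∘ D.tgt) (σ v) := by
    intro n
    induction n using Nat.strong_induction_on with
    | _ n ih =>
      rintro v rfl
      rcases eq_or_ne v s with rfl | hv
      · refine ⟨{[]}, fun p => ?_, ?_⟩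
        · have : ¬ D.IsPath v v p := fun h => lt_irrefl _ (IsPath.lt hσ p h)
          simp [this]
        · rw [hs, upCount_zero, Finset.card_singleton]
      · have hv0 : σ v ≠ 0 := fun h => hv (hinj (h.trans hs.symm))
        have ih' : ∀ e : Fin q, D.tgt e = v → ∃ F : Finset (List (Fin q)),
            (∀ p, p ∈ F ↔ (p = [] ∧ D.src e = s ∨ D.IsPath s (D.src e) p)) ∧
              F.card = upCount (σ ∘ D.src) (σ ∘ D.tgt) (σ (D.src e)) :=
          fun e he => ih _ (he ▸ hσ e) _ rfl
        choose! F hF hFcard using ih'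
        refine ⟨(Finset.univ.filter fun e => D.tgt e = v).biUnion
          fun e => (F e).image (· ++ [e]), fun p => ?_, ?_⟩
        · simp only [Finset.mem_biUnion, Finset.mem_filter, Finset.mem_univ, true_and,
            Finset.mem_image, hv, and_false, false_or]
          constructor
          · rintro ⟨e, he, r, hr, rfl⟩
            exact D.isPath_append_singleton_iff.2 ⟨he, (hF e he r).1 hr⟩
          · intro hp
            obtain ⟨r, e, rfl⟩ := (List.eq_nil_or_concat p).resolve_left hp.ne_nil
            rw [List.concat_eq_append] at hp
            obtain ⟨he, h⟩ := D.isPath_append_singleton_iff.1 hp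
            exact ⟨e, he, r, (hF e he r).2 h, by simp⟩
        · rw [Finset.card_biUnion, upCount_eq_sum (src := σ ∘ D.src) (tgt := σ ∘ D.tgt) hσ hv0, Finset.sum_filter]
          · refine Finset.sum_congr rfl fun e _ => ?_
            simp only [Function.comp_apply, hinj.eq_iff]
            split_ifs with he
            · rw [Finset.card_image_of_injective _ (List.append_left_injective [e]), hFcard e he]
            · rfl
          · intro e _ f _ hef
            refine Finset.disjoint_left.2 ?_
            simp only [Finset.mem_image, not_exists, not_and]
            rintro _ ⟨r, -, rfl⟩ r' - h
            exact hef (List.append_singleton_inj.1 h).2.symm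
  obtain ⟨F, hF, hcard⟩ := key _ v rfl
  rw [← hcard, mu]
  split_ifs with h
  · subst h
    rw [hcard, hs, upCount_zero]
  · exact Nat.subtype_card F fun p => by simp [hF, h]

/-- An acyclic multigraph admits a linear order of its vertices along which all edges increase. -/
theorem Acyclic.exists_perm {D : Multigraph m q} (hD : D.Acyclic) :
    ∃ σ : Equiv.Perm (Fin m), ∀ e, σ (D.src e) < σ (D.tgt e) := by
  classical
  let f : Fin m → ℕ := fun v => (Finset.univ.filter fun u => ∃ p, D.IsPath u v p).card
  have hf : ∀ e, f (D.src e) < f (D.tgt e) := by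
    intro e
    refine Finset.card_lt_card (Finset.ssubset_iff_of_subset ?_ |>.2 ⟨D.src e, ?_, ?_⟩)
    · intro u hu
      simp only [Finset.mem_filter, Finset.mem_univ, true_and] at hu ⊢
      obtain ⟨p, hp⟩ := hu
      exact ⟨p ++ [e], D.isPath_append_singleton_iff.2 ⟨rfl, Or.inr hp⟩⟩
    · simp only [Finset.mem_filter, Finset.mem_univ, true_and]
      exact ⟨[] ++ [e], D.isPath_append_singleton_iff.2 ⟨rfl, Or.inl ⟨rfl, rfl⟩⟩⟩
    · simpa using fun p hp => hD _ ⟨p, hp⟩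
  refine ⟨(Tuple.sort f).symm, fun e => ?_⟩
  by_contra! h
  have h1 := Tuple.monotone_sort f h
  simp only [Function.comp_apply, Equiv.apply_symm_apply] at h1
  exact (hf e).not_ge h1

theorem isOrderedCubic_of_perm {D : Multigraph m q} {s t : Fin m} (hconn : D.EdgeConnected 2)
    (hreg : D.ThreeRegular) (hs : D.UniqueSource s) (ht : D.UniqueSink t)
    {σ : Equiv.Perm (Fin m)} (hσ : ∀ e, σ (D.src e) < σ (D.tgt e)) :
    (σ s).val = 0 ∧ (σ t).val = m - 1 ∧
      IsOrderedCubic m (fun e => (σ (D.src e)).val) (fun e => (σ (D.tgt e)).val) := by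
  have hm : 2 ≤ m := hconn.1
  have htgt : ∀ (v : Fin m) e, (σ (D.tgt e)).val = v.val ↔ D.tgt e = σ.symm v := fun v e => by
    rw [Fin.val_inj, Equiv.eq_symm_apply]
  have hsrc : ∀ (v : Fin m) e, (σ (D.src e)).val = v.val ↔ D.src e = σ.symm v := fun v e => by
    rw [Fin.val_inj, Equiv.eq_symm_apply]
  have hs0 : (σ s).val = 0 := by
    have h : σ.symm ⟨0, by omega⟩ = s := by
      refine hs.2 _ (Finset.card_eq_zero.2 (Finset.filter_eq_empty_iff.2 fun e _ he => ?_))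
      have h1 := hσ e
      rw [he, Equiv.apply_symm_apply] at h1
      exact absurd h1 (by simp [Fin.lt_def])
    rw [← h, Equiv.apply_symm_apply]
  have ht0 : (σ t).val = m - 1 := by
    have h : σ.symm ⟨m - 1, by omega⟩ = t := by
      refine ht.2 _ (Finset.card_eq_zero.2 (Finset.filter_eq_empty_iff.2 fun e _ he => ?_))
      have h1 := hσ e
      have h2 := (σ (D.tgt e)).isLt
      rw [he, Equiv.apply_symm_apply, Fin.lt_def] at h1
      simp only at h1
      omega
    rw [← h, Equiv.apply_symm_apply]
  refine ⟨hs0, ht0, hσ, fun e => (σ (D.tgt e)).isLt, fun v hv => ?_, fun v hv h0 => ?_,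
    fun v hv => ?_, fun k hk => ?_⟩
  · have h1 := hreg (σ.symm ⟨v, hv⟩)
    have h2 := htgt ⟨v, hv⟩
    have h3 := hsrc ⟨v, hv⟩
    simp only at h2 h3
    simpa only [h2, h3, indeg, outdeg] using h1
  · by_contra! hne
    have h1 := hs.2 (σ.symm ⟨v, hv⟩) (Finset.card_eq_zero.2
      (Finset.filter_eq_empty_iff.2 fun e _ he => hne e ((htgt ⟨v, hv⟩ e).2 he)))
    rw [← h1, Equiv.apply_symm_apply] at hs0
    exact h0 hs0
  · by_contra! hne
    have h1 := ht.2 (σ.symm ⟨v, by omega⟩) (Finset.card_eq_zero.2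
      (Finset.filter_eq_empty_iff.2 fun e _ he => hne e ((hsrc ⟨v, by omega⟩ e).2 he)))
    rw [← h1, Equiv.apply_symm_apply] at ht0
    simp only at ht0
    omega
  · by_contra! hlt
    have hst : s ≠ t := by rintro rfl; omega
    have hwalk := hconn.2 _ (Nat.le_of_lt_succ hlt) s t hst
    have hstay : (σ t).val ≤ k := by
      clear ht ht0 hst
      induction hwalk with
      | refl => omega
      | tail _ hadj ih =>
        obtain ⟨e, he, ⟨rfl, rfl⟩ | ⟨rfl, rfl⟩⟩ := hadj
        · by_contra! h
          exact he (by simpa using ⟨ih, h⟩)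
        · exact (Fin.lt_def.1 (hσ e)).le.trans ih
    omega

theorem edgeConnected_two_of_adjacent {D : Multigraph m q} (hm : 2 ≤ m)
    (hcut : ∀ k, k + 1 < m →
      2 ≤ (Finset.univ.filter fun e => (D.src e).val ≤ k ∧ k < (D.tgt e).val).card)
    (hadj : ∀ j, j + 1 < m → ∃ e, (D.src e).val = j ∧ (D.tgt e).val = j + 1) :
    D.EdgeConnected 2 := by
  refine ⟨hm, fun F hF => ?_⟩
  have : Std.Symm (D.Adj {e | e ∉ F}) := ⟨fun a b ⟨e, he, h⟩ => ⟨e, he, h.symm⟩⟩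
  have hsymm : ∀ {a b}, Relation.ReflTransGen (D.Adj {e | e ∉ F}) a b →
      Relation.ReflTransGen (D.Adj {e | e ∉ F}) b a :=
    fun h => Relation.ReflTransGen.stdSymm.symm _ _ h
  have hstep : ∀ e ∉ F, Relation.ReflTransGen (D.Adj {e | e ∉ F}) (D.src e) (D.tgt e) :=
    fun e he => Relation.ReflTransGen.single ⟨e, he, Or.inl ⟨rfl, rfl⟩⟩
  have hinterval : ∀ a b : Fin m, a ≤ b →
      (∀ x y : Fin m, a ≤ x → y ≤ b → y.val = x.val + 1 →
        Relation.ReflTransGen (D.Adj {e | e ∉ F}) x y) →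
      Relation.ReflTransGen (D.Adj {e | e ∉ F}) a b := by
    rintro a ⟨b, hb⟩ hab h
    induction b with
    | zero =>
      obtain rfl : a = ⟨0, hb⟩ := Fin.ext (Nat.le_zero.1 (Fin.le_def.1 hab))
      exact .refl
    | succ b ih =>
      rcases eq_or_lt_of_le hab with rfl | hab
      · exact .refl
      · have hab' : a ≤ ⟨b, by omega⟩ := by
          rw [Fin.lt_def] at hab
          rw [Fin.le_def]
          exact Nat.le_of_lt_succ hab
        refine (ih (by omega) hab' fun x y hx hy => h x y hx (hy.trans ?_)).trans
          (h _ _ hab' le_rfl rfl)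
        simp [Fin.le_def]
  have hsucc : ∀ x y : Fin m, y.val = x.val + 1 →
      Relation.ReflTransGen (D.Adj {e | e ∉ F}) x y := by
    intro x y hxy
    obtain ⟨e, he, he'⟩ := hadj x (by omega)
    obtain rfl : D.src e = x := Fin.ext he
    obtain rfl : D.tgt e = y := Fin.ext (by omega)
    by_cases heF : e ∈ F
    · have hF' : ∀ f ∈ F, f = e := fun f hf => Finset.card_le_one.1 hF f hf e heF
      obtain ⟨c, hc, hce⟩ := Finset.exists_mem_ne (hcut (D.src e) (by omega)) e
      simp only [Finset.mem_filter, Finset.mem_univ, true_and] at hc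
      have hother : ∀ x y : Fin m, x ≠ D.src e → y.val = x.val + 1 →
          Relation.ReflTransGen (D.Adj {e | e ∉ F}) x y := by
        intro x y hx hxy
        obtain ⟨f, hf, hf'⟩ := hadj x (by omega)
        obtain rfl : D.src f = x := Fin.ext hf
        obtain rfl : D.tgt f = y := Fin.ext (by omega)
        exact hstep f fun h => hx (by rw [hF' f h])
      refine .trans (hsymm (hinterval (D.src c) (D.src e) (Fin.le_def.2 hc.1) ?_))
        (.trans (hstep c fun h => hce (hF' c h))
          (hsymm (hinterval (D.tgt e) (D.tgt c) (Fin.le_def.2 (by omega)) ?_)))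
      · rintro x y - hy hxy'
        refine hother x y ?_ hxy'
        rintro rfl
        rw [Fin.le_def] at hy
        omega
      · rintro x y hx - hxy'
        refine hother x y ?_ hxy'
        rintro rfl
        rw [Fin.le_def] at hx
        omega
    · exact hstep e heF
  intro a b _
  rcases le_total a b with h | h
  · exact hinterval a b h fun x y _ _ => hsucc x y
  · exact hsymm (hinterval b a h fun x y _ _ => hsucc x y)

theorem hasHamiltonianPath_of_adjacent {D : Multigraph m q} (hm : 2 ≤ m)
    (hadj : ∀ j, j + 1 < m → ∃ e, (D.src e).val = j ∧ (D.tgt e).val = j + 1) :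
    D.HasHamiltonianPath := by
  obtain ⟨N, rfl⟩ := Nat.exists_eq_add_of_le' hm
  have h : ∀ j : Fin (N + 1), ∃ e, D.src e = j.castSucc ∧ D.tgt e = j.succ := by
    intro j
    obtain ⟨e, he, he'⟩ := hadj j (by omega)
    exact ⟨e, Fin.ext he, Fin.ext he'⟩
  choose g hsrc htgt using h
  have hverts : (0 : Fin (N + 2)) :: (List.ofFn g).map D.tgt = List.ofFn id := by
    rw [List.ofFn_succ (f := (id : Fin (N + 2) → Fin (N + 2))), List.map_ofFn]
    congr 2
    exact funext htgt
  refine ⟨0, List.ofFn g, ⟨Fin.last _, ⟨g 0, _, List.ofFn_succ, hsrc 0⟩,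
    ⟨g (Fin.last _), _, List.ofFn_succ_last, htgt _⟩, ?_⟩, ?_, fun w => ?_⟩
  · rw [List.Chain', List.isChain_ofFn]
    intro i hi
    rw [htgt, hsrc]
    rfl
  · rw [hverts, List.nodup_ofFn]
    exact Function.injective_id
  · rw [hverts, List.mem_ofFn]
    exact ⟨w, rfl⟩

end Multigraph

theorem IsOrderedCubic.exists_multigraph {m q : ℕ} {src tgt : Fin q → ℕ} (hm : 2 ≤ m)
    (G : IsOrderedCubic m src tgt)
    (hadj : ∀ j, j + 1 < m → ∃ e, src e = j ∧ tgt e = j + 1) :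
    ∃ (D : Multigraph m q) (s t : Fin m), D.EdgeConnected 2 ∧ D.ThreeRegular ∧ D.Acyclic ∧
      D.UniqueSource s ∧ D.UniqueSink t ∧ D.HasHamiltonianPath ∧
      D.mu s t = upCount src tgt (m - 1) := by
  let D : Multigraph m q :=
    ⟨fun e => ⟨src e, (G.lt e).trans (G.tgt_lt e)⟩, fun e => ⟨tgt e, G.tgt_lt e⟩⟩
  have hin : ∀ v, D.indeg v = (Finset.univ.filter fun e => tgt e = v.val).card := fun v =>
    congrArg Finset.card (Finset.filter_congr fun e _ => Fin.ext_iff)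
  have hout : ∀ v, D.outdeg v = (Finset.univ.filter fun e => src e = v.val).card := fun v =>
    congrArg Finset.card (Finset.filter_congr fun e _ => Fin.ext_iff)
  refine ⟨D, ⟨0, by omega⟩, ⟨m - 1, by omega⟩,
    Multigraph.edgeConnected_two_of_adjacent hm G.cut hadj,
    fun v => ?_, Multigraph.acyclic_of_lt (σ := Fin.val) fun e => G.lt e,
    ⟨?_, fun v hv => ?_⟩, ⟨?_, fun v hv => ?_⟩,
    Multigraph.hasHamiltonianPath_of_adjacent hm hadj,
    Multigraph.mu_eq_upCount (D := D) Fin.val_injective (fun e => G.lt e) rfl _⟩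
  · rw [hin, hout]
    exact G.deg v v.isLt
  · rw [hin, Finset.card_eq_zero, Finset.filter_eq_empty_iff]
    intro e _ he
    have := G.lt e
    simp only at he
    omega
  · by_contra hne
    obtain ⟨e, he⟩ := G.exists_tgt v v.isLt fun h => hne (Fin.ext h)
    rw [hin, Finset.card_eq_zero, Finset.filter_eq_empty_iff] at hv
    exact hv (Finset.mem_univ e) he
  · rw [hout, Finset.card_eq_zero, Finset.filter_eq_empty_iff]
    intro e _ he
    have h1 := G.lt e
    have h2 := G.tgt_lt e
    simp only at he
    omega
  · by_contra hne
    obtain ⟨e, he⟩ := G.exists_src v (by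
      have : v.val ≠ m - 1 := fun h => hne (Fin.ext h)
      omega)
    rw [hout, Finset.card_eq_zero, Finset.filter_eq_empty_iff] at hv
    exact hv (Finset.mem_univ e) he

/-- Every 2-edge connected, 3-regular acyclic finite directed multigraph on
`2n` vertices with a unique source and unique sink is dominated (in source-to-sink path
count) by a 2-edge connected one with a directed Hamiltonian path. -/
theorem exists_hamiltonian_dominating_twoEdgeConnected (n q : ℕ) (D : Multigraph (2 * n) q)
    (s t : Fin (2 * n)) (hconn : D.EdgeConnected 2) (hreg : D.ThreeRegular)
    (hacy : D.Acyclic) (hs : D.UniqueSource s) (ht : D.UniqueSink t) :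
    ∃ (q' : ℕ) (D' : Multigraph (2 * n) q') (s' t' : Fin (2 * n)),
      D'.EdgeConnected 2 ∧ D'.ThreeRegular ∧ D'.Acyclic ∧ D'.UniqueSource s' ∧
      D'.UniqueSink t' ∧ D'.HasHamiltonianPath ∧ D.mu s t ≤ D'.mu s' t' := by
  obtain ⟨σ, hσ⟩ := hacy.exists_perm
  obtain ⟨hs0, ht0, G⟩ := Multigraph.isOrderedCubic_of_perm hconn hreg hs ht hσ
  obtain ⟨src, tgt, G', hle, hadj⟩ := G.exists_adjacent
  obtain ⟨D', s', t', h1, h2, h3, h4, h5, h6, h7⟩ := G'.exists_multigraph hconn.1 hadj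
  refine ⟨q, D', s', t', h1, h2, h3, h4, h5, h6, ?_⟩
  rw [h7, Multigraph.mu_eq_upCount (σ := fun v => (σ v).val)
    (Fin.val_injective.comp σ.injective) hσ hs0, ht0]
  exact hle
end

section
/- For every 3-edge connected, 3-regular acyclic finite directed multigraph D on 2n vertices with a unique source and a unique sink, there exists a 3-edge connected, 3-regular acyclic finite directed multigraph D' on 2n vertices with a unique source and a unique sink such that D' contains a directed Hamiltonian path and the number of source-to-sink paths of D' is at least the number of source-to-sink paths of D. -/
namespace Multigraph

variable {m q : ℕ}

/-- Some edge goes from `a` to `b`. -/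
def Edge (D : Multigraph m q) (a b : Fin m) : Prop :=
  ∃ e, D.src e = a ∧ D.tgt e = b

theorem not_isPath_nil (D : Multigraph m q) (u v : Fin m) : ¬ D.IsPath u v [] := by
  rintro ⟨⟨e, rest, h, -⟩, -⟩
  simp at h

theorem isPath_cons_iff (D : Multigraph m q) (u v : Fin m) (e : Fin q) (p : List (Fin q)) :
    D.IsPath u v (e :: p) ↔
      D.src e = u ∧ (p = [] ∧ D.tgt e = v ∨ D.IsPath (D.tgt e) v p) := by
  cases p with
  | nil =>
    constructor
    · rintro ⟨⟨a, r, h, ha⟩, ⟨b, r', h', hb⟩, -⟩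
      have h1 := List.cons.inj h
      have h2 : b = e ∧ r' = [] := by
        cases r' with
        | nil => simpa using h'.symm
        | cons x xs => simp at h'
      rw [h2.1] at hb
      exact ⟨h1.1 ▸ ha, Or.inl ⟨rfl, hb⟩⟩
    · rintro ⟨h, ⟨-, h'⟩ | h'⟩
      · exact ⟨⟨e, [], rfl, h⟩, ⟨e, [], rfl, h'⟩, List.isChain_singleton _⟩
      · exact absurd h' (D.not_isPath_nil _ _)
  | cons a p =>
    constructor
    · rintro ⟨⟨a', r, h, ha⟩, ⟨b, r', h', hb⟩, hc⟩
      have h1 := List.cons.inj h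
      have hc' := List.isChain_cons_cons.1 hc
      refine ⟨h1.1 ▸ ha, Or.inr ⟨⟨a, p, rfl, hc'.1.symm⟩, ?_, hc'.2⟩⟩
      cases r' with
      | nil => simp at h'
      | cons x xs => exact ⟨b, xs, (List.cons.inj h').2, hb⟩
    · rintro ⟨h, ⟨h', -⟩ | ⟨⟨a', r, h1, ha⟩, ⟨b, r', h', hb⟩, hc⟩⟩
      · simp at h'
      · have h2 := List.cons.inj h1
        exact ⟨⟨e, _, rfl, h⟩, ⟨b, e :: r', by rw [h']; rfl, hb⟩,
          List.isChain_cons_cons.2 ⟨by rw [h2.1, ha], hc⟩⟩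

/-- A path followed by an edge leaving its last vertex. -/
theorem IsPath.concat {D : Multigraph m q} {u v : Fin m} {p : List (Fin q)}
    (h : D.IsPath u v p) {e : Fin q} (he : D.src e = v) : D.IsPath u (D.tgt e) (p ++ [e]) := by
  induction p generalizing u with
  | nil => exact absurd h (D.not_isPath_nil _ _)
  | cons a p ih =>
    rw [isPath_cons_iff] at h
    rw [List.cons_append, isPath_cons_iff]
    refine ⟨h.1, Or.inr ?_⟩
    rcases h.2 with ⟨rfl, h'⟩ | h'
    · rw [List.nil_append, isPath_cons_iff]
      exact ⟨by rw [he, h'], Or.inl ⟨rfl, rfl⟩⟩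
    · exact ih h'

theorem exists_isPath_of_transGen {D : Multigraph m q} {u v : Fin m}
    (h : Relation.TransGen D.Edge u v) : ∃ p, D.IsPath u v p := by
  induction h with
  | single h =>
    obtain ⟨e, rfl, rfl⟩ := h
    exact ⟨[e], (D.isPath_cons_iff _ _ _ _).2 ⟨rfl, Or.inl ⟨rfl, rfl⟩⟩⟩
  | tail _ h ih =>
    obtain ⟨e, he, rfl⟩ := h
    obtain ⟨p, hp⟩ := ih
    exact ⟨_, hp.concat he⟩

/-- `r` strictly increases along every edge. -/
def IsRank (D : Multigraph m q) (r : Fin m → ℕ) : Prop :=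
  ∀ e, r (D.src e) < r (D.tgt e)

theorem Acyclic.exists_isRank {D : Multigraph m q} (h : D.Acyclic) : ∃ r, D.IsRank r := by
  classical
  refine ⟨fun v => (Finset.univ.filter fun u => Relation.TransGen D.Edge u v).card, fun e => ?_⟩
  have hE : D.Edge (D.src e) (D.tgt e) := ⟨e, rfl, rfl⟩
  refine Finset.card_lt_card (Finset.ssubset_iff_of_subset ?_ |>.2 ⟨D.src e, ?_, ?_⟩)
  · intro u hu
    simp only [Finset.mem_filter, Finset.mem_univ, true_and] at hu ⊢
    exact hu.tail hE
  · simpa using Relation.TransGen.single hE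
  · simp only [Finset.mem_filter, Finset.mem_univ, true_and]
    exact fun hc => h _ (exists_isPath_of_transGen hc)

theorem IsRank.lt_of_isPath {D : Multigraph m q} {r : Fin m → ℕ} (hr : D.IsRank r)
    {u v : Fin m} {p : List (Fin q)} (h : D.IsPath u v p) : r u < r v := by
  induction p generalizing u with
  | nil => exact absurd h (D.not_isPath_nil _ _)
  | cons a p ih =>
    obtain ⟨rfl, ⟨-, rfl⟩ | h'⟩ := (D.isPath_cons_iff _ _ _ _).1 h
    · exact hr a
    · exact (hr a).trans (ih h')

theorem IsRank.acyclic {D : Multigraph m q} {r : Fin m → ℕ} (hr : D.IsRank r) : D.Acyclic :=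
  fun _ ⟨_, hp⟩ => lt_irrefl _ (hr.lt_of_isPath hp)

theorem IsRank.finite_isPath {D : Multigraph m q} {r : Fin m → ℕ} (hr : D.IsRank r)
    (u v : Fin m) : {p | D.IsPath u v p}.Finite := by
  induction hk : r v - r u using Nat.strong_induction_on generalizing u with
  | _ k ih =>
    have hsub : {p | D.IsPath u v p} ⊆
        {[]} ∪ ⋃ e ∈ {e | D.src e = u ∧ r u < r v},
          (fun p => e :: p) '' ({[]} ∪ {p | D.IsPath (D.tgt e) v p}) := by
      rintro (_ | ⟨e, p⟩) hp
      · exact Or.inl rfl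
      · have hlt := hr.lt_of_isPath hp
        obtain ⟨h1, h2⟩ := (D.isPath_cons_iff _ _ _ _).1 hp
        refine Or.inr (Set.mem_biUnion (show e ∈ _ from ⟨h1, hlt⟩) ⟨p, ?_, rfl⟩)
        exact h2.imp (fun h => h.1) id
    refine Set.Finite.subset ((Set.finite_singleton _).union
      (Set.Finite.biUnion (Set.toFinite _) ?_)) hsub
    rintro e ⟨rfl, hlt⟩
    have := hr e
    exact ((Set.finite_singleton _).union (ih _ (by omega) _ rfl)).image _

theorem IsRank.pathCount_eq {D : Multigraph m q} {r : Fin m → ℕ} (hr : D.IsRank r)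
    (u v : Fin m) :
    D.pathCount u v = ∑ e ∈ Finset.univ.filter (fun e => D.src e = u), D.mu (D.tgt e) v := by
  classical
  have hfin : ∀ a, Finite {p : List (Fin q) // p = [] ∧ a = v ∨ D.IsPath a v p} := by
    intro a
    refine Set.Finite.to_subtype (s := {p | p = [] ∧ a = v ∨ D.IsPath a v p})
      (((Set.finite_singleton []).union (hr.finite_isPath a v)).subset ?_)
    exact fun p hp => hp.imp (fun h => h.1) id
  have hmu : ∀ a, Nat.card {p : List (Fin q) // p = [] ∧ a = v ∨ D.IsPath a v p} = D.mu a v := by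
    intro a
    by_cases h : v = a
    · subst h
      rw [mu, if_pos rfl, Nat.card_eq_one_iff_unique]
      have hp : ∀ p, ¬ D.IsPath v v p := fun p hp => hr.acyclic v ⟨p, hp⟩
      refine ⟨⟨?_⟩, ⟨[], Or.inl ⟨rfl, rfl⟩⟩⟩
      rintro ⟨p, hp1⟩ ⟨p', hp2⟩
      simp only [hp, or_false, and_true] at hp1 hp2
      simp [hp1, hp2]
    · rw [mu, if_neg h, pathCount]
      exact Nat.card_congr (Equiv.subtypeEquivRight fun p => by simp [Ne.symm h])
  let φ : {p : List (Fin q) // D.IsPath u v p} ≃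
      Σ e : {e : Fin q // D.src e = u},
        {p : List (Fin q) // p = [] ∧ D.tgt e = v ∨ D.IsPath (D.tgt e) v p} :=
    { toFun := fun p => match p with
        | ⟨[], hp⟩ => absurd hp (D.not_isPath_nil _ _)
        | ⟨e :: p, hp⟩ => ⟨⟨e, ((D.isPath_cons_iff _ _ _ _).1 hp).1⟩,
            ⟨p, ((D.isPath_cons_iff _ _ _ _).1 hp).2⟩⟩
      invFun := fun x => ⟨x.1.1 :: x.2.1, (D.isPath_cons_iff _ _ _ _).2 ⟨x.1.2, x.2.2⟩⟩
      left_inv := by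
        rintro ⟨_ | ⟨e, p⟩, hp⟩
        · exact absurd hp (D.not_isPath_nil _ _)
        · rfl
      right_inv := by
        rintro ⟨⟨e, he⟩, ⟨p, hp⟩⟩
        rfl }
  rw [pathCount, Nat.card_congr φ, Nat.card_sigma]
  simp only [hmu]
  exact (Finset.sum_subtype _ (by simp) (fun e => D.mu (D.tgt e) v)).symm

theorem tgt_ne_of_indeg_eq_zero {D : Multigraph m q} {s : Fin m} (h : D.indeg s = 0)
    (e : Fin q) : D.tgt e ≠ s := by
  intro he
  have : e ∈ Finset.univ.filter (fun e => D.tgt e = s) := by simp [he]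
  rw [Finset.card_eq_zero.1 h] at this
  simp at this

theorem IsRank.mu_sink {D : Multigraph m q} {r : Fin m → ℕ} (hr : D.IsRank r)
    {t : Fin m} (ht : D.outdeg t = 0) (v : Fin m) :
    D.mu v t = (if v = t then 1 else 0) +
      ∑ e ∈ Finset.univ.filter (fun e => D.src e = v), D.mu (D.tgt e) t := by
  by_cases h : v = t
  · subst h
    rw [mu, if_pos rfl, if_pos rfl, Finset.card_eq_zero.1 ht, Finset.sum_empty, add_zero]
  · rw [if_neg h, zero_add, ← hr.pathCount_eq, mu, if_neg (Ne.symm h)]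

/-- The function counting the directed paths issuing from `s`, as the solution of the
forward recursion. -/
theorem IsRank.exists_forward {D : Multigraph m q} {r : Fin m → ℕ} (hr : D.IsRank r)
    (s : Fin m) : ∃ f : Fin m → ℕ, ∀ v, f v = (if v = s then 1 else 0) +
      ∑ e ∈ Finset.univ.filter (fun e => D.tgt e = v), f (D.src e) := by
  have wf : WellFounded fun a b : Fin m => r a < r b := (measure r).wf
  obtain ⟨F, hF⟩ : ∃ F : Fin m → ℕ, ∀ v, F v = (if v = s then 1 else 0) +
      ∑ e : {e // D.tgt e = v}, F (D.src e) :=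
    ⟨wf.fix fun v F => (if v = s then 1 else 0) +
      ∑ e : {e // D.tgt e = v}, F (D.src e) ((hr e).trans_eq (congrArg r e.2)),
      fun v => wf.fix_eq _ v⟩
  refine ⟨F, fun v => (hF v).trans ?_⟩
  congr 1
  exact (Finset.sum_subtype _ (by simp) (fun e => F (D.src e))).symm

theorem forward_backward {D D' : Multigraph m q} (hsrc : D'.src = D.src) {s t : Fin m}
    {f g : Fin m → ℕ}
    (hf : ∀ v, f v = (if v = s then 1 else 0) +
      ∑ e ∈ Finset.univ.filter (fun e => D'.tgt e = v), f (D'.src e))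
    (hg : ∀ v, g v = (if v = t then 1 else 0) +
      ∑ e ∈ Finset.univ.filter (fun e => D.src e = v), g (D.tgt e)) :
    f t + ∑ e, f (D.src e) * g (D.tgt e) = g s + ∑ e, f (D.src e) * g (D'.tgt e) := by
  have h1 : ∑ v, f v * g v = g s + ∑ e, f (D.src e) * g (D'.tgt e) := by
    rw [← Finset.sum_fiberwise Finset.univ D'.tgt]
    have : ∀ v, f v * g v = (if v = s then g s else 0) +
        ∑ e ∈ Finset.univ.filter (fun e => D'.tgt e = v), f (D.src e) * g (D'.tgt e) := by
      intro v
      rw [hf v, add_mul, Finset.sum_mul, hsrc]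
      congr 1
      · split_ifs with h <;> simp [h]
      · refine Finset.sum_congr rfl fun e he => ?_
        rw [(Finset.mem_filter.1 he).2]
    simp only [this, Finset.sum_add_distrib, Finset.sum_ite_eq', Finset.mem_univ, if_true]
  have h2 : ∑ v, f v * g v = f t + ∑ e, f (D.src e) * g (D.tgt e) := by
    rw [← Finset.sum_fiberwise Finset.univ D.src]
    have : ∀ v, f v * g v = (if v = t then f t else 0) +
        ∑ e ∈ Finset.univ.filter (fun e => D.src e = v), f (D.src e) * g (D.tgt e) := by
      intro v
      rw [hg v, mul_add, Finset.mul_sum]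
      congr 1
      · split_ifs with h <;> simp [h]
      · refine Finset.sum_congr rfl fun e he => ?_
        rw [(Finset.mem_filter.1 he).2]
    simp only [this, Finset.sum_add_distrib, Finset.sum_ite_eq', Finset.mem_univ, if_true]
  rw [← h1, h2]

/-- Exchange the targets of two edges. -/
def swapTgt (D : Multigraph m q) (e f : Fin q) : Multigraph m q where
  src := D.src
  tgt := fun g => D.tgt (Equiv.swap e f g)

theorem swapTgt_src (D : Multigraph m q) (e f : Fin q) : (D.swapTgt e f).src = D.src := rfl

theorem swapTgt_tgt_left (D : Multigraph m q) (e f : Fin q) :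
    (D.swapTgt e f).tgt e = D.tgt f := by simp [swapTgt]

theorem swapTgt_tgt_right (D : Multigraph m q) (e f : Fin q) :
    (D.swapTgt e f).tgt f = D.tgt e := by simp [swapTgt]

theorem swapTgt_tgt_of_ne (D : Multigraph m q) {e f g : Fin q} (he : g ≠ e) (hf : g ≠ f) :
    (D.swapTgt e f).tgt g = D.tgt g := by simp [swapTgt, Equiv.swap_apply_of_ne_of_ne he hf]

theorem swapTgt_outdeg (D : Multigraph m q) (e f : Fin q) (v : Fin m) :
    (D.swapTgt e f).outdeg v = D.outdeg v := rfl

theorem swapTgt_indeg (D : Multigraph m q) (e f : Fin q) (v : Fin m) :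
    (D.swapTgt e f).indeg v = D.indeg v := by
  unfold indeg
  refine Finset.card_equiv (Equiv.swap e f) fun g => ?_
  simp only [Finset.mem_filter, Finset.mem_univ, true_and]
  rfl

/-- Splitting off two summands. -/
theorem sum_eq_add_add_sum_erase {q : ℕ} (F : Fin q → ℕ) {e f : Fin q} (hef : e ≠ f) :
    ∑ g, F g = F e + (F f + ∑ g ∈ (Finset.univ.erase e).erase f, F g) := by
  rw [Finset.add_sum_erase _ F (Finset.mem_erase.2 ⟨hef.symm, Finset.mem_univ _⟩),
    Finset.add_sum_erase _ F (Finset.mem_univ e)]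

theorem mu_le_mu_swapTgt {D : Multigraph m q} {r r' : Fin m → ℕ} (hr : D.IsRank r) {e f : Fin q}
    (hef : e ≠ f) (hr' : (D.swapTgt e f).IsRank r') {s t : Fin m}
    (ht : D.outdeg t = 0)
    (hgain : ∀ F : Fin m → ℕ, (∀ v, F v = (if v = s then 1 else 0) +
      ∑ g ∈ Finset.univ.filter (fun g => (D.swapTgt e f).tgt g = v), F (D.src g)) →
      F (D.src e) = F (D.src f) ∨
        F (D.src f) ≤ F (D.src e) ∧ D.mu (D.tgt e) t ≤ D.mu (D.tgt f) t) :
    D.mu s t ≤ (D.swapTgt e f).mu s t := by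
  obtain ⟨F, hF⟩ := hr'.exists_forward s
  have h1 := forward_backward (D := D.swapTgt e f) (D' := D.swapTgt e f) rfl hF
    (hr'.mu_sink (t := t) ht)
  have h2 := forward_backward (D := D) (D' := D.swapTgt e f) rfl hF (hr.mu_sink ht)
  have h3 : F t = (D.swapTgt e f).mu s t := by
    have := Nat.add_right_cancel h1
    exact this
  rw [h3, sum_eq_add_add_sum_erase _ hef, sum_eq_add_add_sum_erase _ hef,
    swapTgt_tgt_left, swapTgt_tgt_right] at h2
  have h4 : ∑ g ∈ (Finset.univ.erase e).erase f, F (D.src g) * D.mu ((D.swapTgt e f).tgt g) t =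
      ∑ g ∈ (Finset.univ.erase e).erase f, F (D.src g) * D.mu (D.tgt g) t := by
    refine Finset.sum_congr rfl fun g hg => ?_
    simp only [Finset.mem_erase, Finset.mem_univ, and_true] at hg
    rw [swapTgt_tgt_of_ne _ hg.2 hg.1]
  rw [h4] at h2
  rcases hgain F hF with h | ⟨h, h'⟩
  · rw [h] at h2
    linarith
  · nlinarith [Nat.mul_le_mul h h', mul_add_mul_le_mul_add_mul h h']

/-- The edges with exactly one endpoint in `X`. -/
def cut (D : Multigraph m q) (X : Finset (Fin m)) : Finset (Fin q) :=
  Finset.univ.filter fun e => ¬ (D.src e ∈ X ↔ D.tgt e ∈ X)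

theorem mem_cut {D : Multigraph m q} {X : Finset (Fin m)} {e : Fin q} :
    e ∈ D.cut X ↔ ¬ (D.src e ∈ X ↔ D.tgt e ∈ X) := by
  simp [cut]

/-- Every proper nonempty vertex set is left by at least three edges. -/
def CutBound (D : Multigraph m q) : Prop :=
  ∀ (X : Finset (Fin m)) (a b : Fin m), a ∈ X → b ∉ X → 3 ≤ (D.cut X).card

theorem edgeConnected_three_iff (D : Multigraph m q) :
    D.EdgeConnected 3 ↔ 2 ≤ m ∧ D.CutBound := by
  classical
  refine and_congr_right fun _ => ⟨fun h X a b ha hb => ?_, fun h F hF a b _ => ?_⟩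
  · by_contra! hlt
    have hab := h (D.cut X) (by omega) a b (by rintro rfl; exact hb ha)
    refine hb ?_
    clear hb
    induction hab with
    | refl => exact ha
    | tail _ hcd ih =>
      obtain ⟨e, he, hcd⟩ := hcd
      simp only [Set.mem_ofPred_eq, mem_cut, not_not] at he
      rcases hcd with ⟨rfl, rfl⟩ | ⟨rfl, rfl⟩
      · exact he.1 ih
      · exact he.2 ih
  · by_contra hab
    let X := Finset.univ.filter fun c => Relation.ReflTransGen (D.Adj {e | e ∉ F}) a c
    have hX : ∀ c, c ∈ X ↔ Relation.ReflTransGen (D.Adj {e | e ∉ F}) a c := by simp [X]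
    have h3 := h X a b ((hX a).2 .refl) (fun hb => hab ((hX b).1 hb))
    have hsub : D.cut X ⊆ F := by
      intro e he
      by_contra heF
      refine mem_cut.1 he ⟨fun h' => ?_, fun h' => ?_⟩
      · exact (hX _).2 (((hX _).1 h').tail ⟨e, heF, Or.inl ⟨rfl, rfl⟩⟩)
      · exact (hX _).2 (((hX _).1 h').tail ⟨e, heF, Or.inr ⟨rfl, rfl⟩⟩)
    have := Finset.card_le_card hsub
    omega

theorem cut_compl (D : Multigraph m q) (X : Finset (Fin m)) : D.cut Xᶜ = D.cut X := by
  ext e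
  simp only [mem_cut, Finset.mem_compl]
  tauto

theorem card_cut_eq_sum (D : Multigraph m q) (X : Finset (Fin m)) :
    (D.cut X).card = ∑ e, if D.src e ∈ X ↔ D.tgt e ∈ X then 0 else 1 := by
  rw [cut, Finset.card_filter]
  simp only [ite_not]

theorem card_cut_inter_add_card_cut_union_le (D : Multigraph m q) (X Y : Finset (Fin m)) :
    (D.cut (X ∩ Y)).card + (D.cut (X ∪ Y)).card ≤ (D.cut X).card + (D.cut Y).card := by
  simp only [card_cut_eq_sum, ← Finset.sum_add_distrib]
  refine Finset.sum_le_sum fun e _ => ?_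
  simp only [Finset.mem_inter, Finset.mem_union]
  by_cases h1 : D.src e ∈ X <;> by_cases h2 : D.src e ∈ Y <;> by_cases h3 : D.tgt e ∈ X <;>
    by_cases h4 : D.tgt e ∈ Y <;> simp [h1, h2, h3, h4]

theorem CutBound.swapTgt {D : Multigraph m q} (hD : D.CutBound) {e f : Fin q} (hef : e ≠ f)
    (h : ∀ X : Finset (Fin m), D.src e ∈ X → D.tgt f ∈ X → D.src f ∉ X → D.tgt e ∉ X →
      5 ≤ (D.cut X).card) : (D.swapTgt e f).CutBound := by
  intro X a b ha hb
  have h3 := hD X a b ha hb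
  have h5 := h X
  have h5' := h Xᶜ
  rw [cut_compl] at h5'
  rw [card_cut_eq_sum, sum_eq_add_add_sum_erase _ hef] at h3 h5 h5' ⊢
  have hrest : ∑ g ∈ (Finset.univ.erase e).erase f,
      (if (D.swapTgt e f).src g ∈ X ↔ (D.swapTgt e f).tgt g ∈ X then 0 else 1) =
      ∑ g ∈ (Finset.univ.erase e).erase f, if D.src g ∈ X ↔ D.tgt g ∈ X then 0 else 1 := by
    refine Finset.sum_congr rfl fun g hg => ?_
    simp only [Finset.mem_erase, Finset.mem_univ, and_true] at hg
    rw [swapTgt_tgt_of_ne _ hg.2 hg.1, swapTgt_src]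
  rw [hrest, swapTgt_tgt_left, swapTgt_tgt_right, swapTgt_src]
  simp only [Finset.mem_compl] at h5'
  by_cases k1 : D.src e ∈ X <;> by_cases k2 : D.src f ∈ X <;> by_cases k3 : D.tgt e ∈ X <;>
    by_cases k4 : D.tgt f ∈ X <;> simp [k1, k2, k3, k4] at h3 h5 h5' ⊢ <;> omega

/-- A sequence of related elements leading from `X` to its complement leaves `X` somewhere. -/
theorem exists_rel_of_reflTransGen {α : Type*} {R : α → α → Prop} {a b : α} {p : α → Prop}
    (h : Relation.ReflTransGen R a b) (ha : p a) (hb : ¬ p b) :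
    ∃ c d, R c d ∧ p c ∧ ¬ p d := by
  induction h with
  | refl => exact absurd ha hb
  | @tail c d _ hcd ih =>
    by_cases hc : p c
    · exact ⟨c, d, hcd, hc, hb⟩
    · exact ih hc

/-- `L` lists, from last to first, the vertices of a directed path, and no edge enters
this set of vertices from outside. -/
structure IsInitialChain (D : Multigraph m q) (L : List (Fin m)) : Prop where
  isChain : L.IsChain fun a b => D.Edge b a
  src_mem : ∀ e, D.tgt e ∈ L → D.src e ∈ L

theorem reflTransGen_of_isChain_cons {D : Multigraph m q} {u x : Fin m} {L : List (Fin m)}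
    (h : (u :: L).IsChain fun a b => D.Edge b a) (hx : x ∈ u :: L) :
    Relation.ReflTransGen (fun a b => ∃ e, D.src e = a ∧ D.tgt e = b ∧ b ∈ u :: L) x u := by
  induction L generalizing u with
  | nil =>
    obtain rfl : x = u := by simpa using hx
    exact .refl
  | cons v L ih =>
    rw [List.isChain_cons_cons] at h
    rcases List.mem_cons.1 hx with rfl | hx
    · exact .refl
    · obtain ⟨e, he, he'⟩ := h.1
      refine Relation.ReflTransGen.tail ?_ ⟨e, he, he', List.mem_cons_self⟩
      exact Relation.ReflTransGen.mono (fun a b ⟨e, h1, h2, h3⟩ =>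
        ⟨e, h1, h2, List.mem_cons_of_mem _ h3⟩) _ _ (ih h.2 hx)

theorem reflTransGen_or_of_isChain {D : Multigraph m q} {x y : Fin m} {L : List (Fin m)}
    (h : L.IsChain fun a b => D.Edge b a) (hx : x ∈ L) (hy : y ∈ L) :
    Relation.ReflTransGen (fun a b => ∃ e, D.src e = a ∧ D.tgt e = b ∧ b ∈ L) x y ∨
      Relation.ReflTransGen (fun a b => ∃ e, D.src e = a ∧ D.tgt e = b ∧ b ∈ L) y x := by
  induction L with
  | nil => simp at hx
  | cons v L ih =>
    rcases List.mem_cons.1 hx with rfl | hx'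
    · exact Or.inr (reflTransGen_of_isChain_cons h hy)
    · rcases List.mem_cons.1 hy with rfl | hy'
      · exact Or.inl (reflTransGen_of_isChain_cons h hx)
      · have hmono : ∀ a b, (∃ e, D.src e = a ∧ D.tgt e = b ∧ b ∈ L) →
            ∃ e, D.src e = a ∧ D.tgt e = b ∧ b ∈ v :: L :=
          fun a b ⟨e, h1, h2, h3⟩ => ⟨e, h1, h2, List.mem_cons_of_mem _ h3⟩
        exact (ih h.tail hx' hy').imp (Relation.ReflTransGen.mono hmono _ _)
          (Relation.ReflTransGen.mono hmono _ _)

theorem IsRank.nodup_of_isChain {D : Multigraph m q} {r : Fin m → ℕ} (hr : D.IsRank r)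
    {L : List (Fin m)} (h : L.IsChain fun a b => D.Edge b a) : L.Nodup := by
  have h1 : L.IsChain (fun a b => r b < r a) := h.imp fun a b ⟨e, h1, h2⟩ => by
    rw [← h1, ← h2]; exact hr e
  have : Trans (fun a b : Fin m => r b < r a) (fun a b => r b < r a) (fun a b => r b < r a) :=
    ⟨fun h h' => h'.trans h⟩
  exact h1.pairwise.imp fun h => by rintro rfl; exact lt_irrefl _ h

/-- Outside a set closed under predecessors, every vertex has an ancestor all of whose
predecessors lie in the set. -/
theorem IsRank.exists_minimal {D : Multigraph m q} {r : Fin m → ℕ} (hr : D.IsRank r)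
    (L : List (Fin m)) {y : Fin m} (hy : y ∉ L) :
    ∃ w, w ∉ L ∧ (∀ e, D.tgt e = w → D.src e ∈ L) ∧
      Relation.ReflTransGen (fun a b => ∃ e, D.src e = a ∧ D.tgt e = b ∧ a ∉ L) w y := by
  induction hk : r y using Nat.strong_induction_on generalizing y with
  | _ k ih =>
    by_cases h : ∀ e, D.tgt e = y → D.src e ∈ L
    · exact ⟨y, hy, h, .refl⟩
    · push Not at h
      obtain ⟨e, rfl, he⟩ := h
      obtain ⟨w, hw, hw', hp⟩ := ih _ (hk ▸ hr e) he rfl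
      exact ⟨w, hw, hw', hp.tail ⟨e, rfl, rfl, he⟩⟩

theorem IsRank.hasHamiltonianPath {D : Multigraph m q} {r : Fin m → ℕ} (hr : D.IsRank r)
    (hm : 2 ≤ m) {L : List (Fin m)} (h : L.IsChain fun a b => D.Edge b a) (hL : ∀ v, v ∈ L) :
    D.HasHamiltonianPath := by
  have key : ∀ (L : List (Fin m)) (u : Fin m), (u :: L).IsChain (fun a b => D.Edge b a) →
      ∃ s p, s :: p.map D.tgt = (u :: L).reverse ∧ (p = [] ∧ s = u ∨ D.IsPath s u p) := by
    intro L
    induction L with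
    | nil => exact fun u _ => ⟨u, [], rfl, Or.inl ⟨rfl, rfl⟩⟩
    | cons v L ih =>
      intro u hu
      obtain ⟨⟨e, he, rfl⟩, hv⟩ := List.isChain_cons_cons.1 hu
      obtain ⟨s, p, hp, hp'⟩ := ih v hv
      refine ⟨s, p ++ [e], ?_, Or.inr ?_⟩
      · rw [List.reverse_cons, ← hp]
        simp
      · rcases hp' with ⟨rfl, rfl⟩ | hp'
        · exact (D.isPath_cons_iff _ _ _ _).2 ⟨he, Or.inl ⟨rfl, rfl⟩⟩
        · exact hp'.concat he
  have hnd := hr.nodup_of_isChain h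
  cases L with
  | nil => exact absurd (hL ⟨0, by omega⟩) (by simp)
  | cons u L =>
    obtain ⟨s, p, hp, hp'⟩ := key L u h
    refine ⟨s, p, ⟨u, ?_⟩, ?_, ?_⟩
    · refine hp'.resolve_left ?_
      rintro ⟨rfl, rfl⟩
      have h1 : ∀ v, v = s := by
        intro v
        have : v ∈ (s :: L).reverse := List.mem_reverse.2 (hL v)
        rw [← hp] at this
        simpa using this
      have h2 := (h1 ⟨0, by omega⟩).trans (h1 ⟨1, by omega⟩).symm
      simp at h2
    · rw [hp]
      exact List.nodup_reverse.2 hnd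
    · intro w
      rw [hp]
      exact List.mem_reverse.2 (hL w)

/-- The graphs under consideration: 3-regular, acyclic, with unique source and sink, and
satisfying the cut condition for 3-edge connectivity. -/
structure IsCubicNetwork (D : Multigraph m q) (s t : Fin m) : Prop where
  cutBound : D.CutBound
  threeRegular : D.ThreeRegular
  acyclic : D.Acyclic
  uniqueSource : D.UniqueSource s
  uniqueSink : D.UniqueSink t

theorem IsCubicNetwork.swapTgt {D : Multigraph m q} {s t : Fin m} (h : D.IsCubicNetwork s t)
    {e f : Fin q} {r : Fin m → ℕ} (hr : (D.swapTgt e f).IsRank r)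
    (hcut : (D.swapTgt e f).CutBound) : (D.swapTgt e f).IsCubicNetwork s t where
  cutBound := hcut
  threeRegular v := by
    rw [swapTgt_indeg, swapTgt_outdeg]
    exact h.threeRegular v
  acyclic := hr.acyclic
  uniqueSource := by
    simp only [UniqueSource, swapTgt_indeg]
    exact h.uniqueSource
  uniqueSink := h.uniqueSink

theorem le_of_reflTransGen {α : Type*} {R : α → α → Prop} {F : α → ℕ} {a b : α}
    (h : Relation.ReflTransGen R a b) (hF : ∀ a b, R a b → F a ≤ F b) : F a ≤ F b := by
  induction h with
  | refl => exact le_rfl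
  | tail _ hcd ih => exact ih.trans (hF _ _ hcd)

theorem IsRank.mu_tgt_le_mu_src {D : Multigraph m q} {r : Fin m → ℕ} (hr : D.IsRank r)
    {t : Fin m} (ht : D.outdeg t = 0) (g : Fin q) : D.mu (D.tgt g) t ≤ D.mu (D.src g) t := by
  rw [hr.mu_sink ht (D.src g)]
  refine le_add_left ?_
  exact Finset.single_le_sum (f := fun e => D.mu (D.tgt e) t) (fun _ _ => Nat.zero_le _)
    (by simp)

/-- If some vertex `w` outside the chain has two edges coming from the chain, then the chain can
be extended by `w` after an exchange of targets. -/
theorem IsCubicNetwork.exists_cons_of_two_edges {D : Multigraph m q} {s t : Fin m}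
    (h : D.IsCubicNetwork s t) {L : List (Fin m)} {e f f' : Fin q}
    (hL : D.IsInitialChain (D.src e :: L)) (he : D.tgt e ∉ D.src e :: L)
    (hf : D.tgt f ∉ D.src e :: L) (hin : ∀ g, D.tgt g = D.tgt f → D.src g ∈ D.src e :: L)
    (hadj : ∀ g, D.src g = D.src e → D.tgt g ≠ D.tgt f) (hf' : D.tgt f' = D.tgt f) (hne : f' ≠ f)
    (hpath : Relation.ReflTransGen
      (fun a b => ∃ g, D.src g = a ∧ D.tgt g = b ∧ a ∉ D.src e :: L) (D.tgt f) (D.tgt e))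
    (hord : Relation.ReflTransGen
      (fun a b => ∃ g, D.src g = a ∧ D.tgt g = b ∧ b ∈ D.src e :: L) (D.src f') (D.src f)) :
    (D.swapTgt e f).IsCubicNetwork s t ∧
      (D.swapTgt e f).IsInitialChain (D.tgt f :: D.src e :: L) ∧
      D.mu s t ≤ (D.swapTgt e f).mu s t := by
  classical
  obtain ⟨r, hr⟩ := h.acyclic.exists_isRank
  have hef : e ≠ f := fun hh => hadj e rfl (congrArg D.tgt hh)
  have heL : D.src e ∈ D.src e :: L := List.mem_cons_self
  have hfL : D.src f ∈ D.src e :: L := hin f rfl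
  have hchain := reflTransGen_of_isChain_cons hL.isChain hfL
  have hsame : ∀ g, D.tgt g ∈ D.src e :: L → (D.swapTgt e f).tgt g = D.tgt g := fun g hg =>
    swapTgt_tgt_of_ne _ (fun hh => he (hh ▸ hg)) (fun hh => hf (hh ▸ hg))
  have hr' : (D.swapTgt e f).IsRank
      fun v => if v ∈ D.src e :: L then r v else r v + (r (D.src e) + r (D.src f) + 1) := by
    intro g
    rw [swapTgt_src]
    beta_reduce
    by_cases h1 : g = e
    · subst h1
      rw [swapTgt_tgt_left, if_pos heL, if_neg hf]
      omega
    by_cases h2 : g = f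
    · subst h2
      rw [swapTgt_tgt_right, if_pos hfL, if_neg he]
      omega
    rw [swapTgt_tgt_of_ne _ h1 h2]
    have := hr g
    have := hL.src_mem g
    split_ifs <;> first | omega | tauto
  refine ⟨h.swapTgt hr' (h.cutBound.swapTgt hef ?_), ⟨?_, ?_⟩,
    mu_le_mu_swapTgt hr hef hr' h.uniqueSink.1 ?_⟩
  · intro X heX hfX hfX' heX'
    obtain ⟨_, _, ⟨a, rfl, rfl, ha⟩, ha1, ha2⟩ :=
      exists_rel_of_reflTransGen (p := (· ∈ X)) hpath hfX heX'
    obtain ⟨_, _, ⟨b, rfl, rfl, hb⟩, hb1, hb2⟩ :=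
      exists_rel_of_reflTransGen (p := (· ∉ X)) hchain hfX' (not_not.2 heX)
    have hc : ∃ c ∈ D.cut X, c ≠ e ∧ c ≠ f ∧ c ≠ a ∧ c ≠ b := by
      by_cases hX : D.src f' ∈ X
      · obtain ⟨_, _, ⟨c, rfl, rfl, hc⟩, hc1, hc2⟩ :=
          exists_rel_of_reflTransGen (p := (· ∈ X)) hord hX hfX'
        refine ⟨c, by simp [mem_cut, hc1, hc2], ?_, ?_, ?_, ?_⟩
        · rintro rfl; exact he hc
        · rintro rfl; exact hf hc
        · rintro rfl; exact ha (hL.src_mem _ hc)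
        · rintro rfl; exact hb1 hc1
      · refine ⟨f', by simp [mem_cut, hX, hf', hfX], ?_, hne, ?_, ?_⟩
        · rintro rfl; exact hX heX
        · rintro rfl; exact hX ha1
        · rintro rfl; exact hf (hf' ▸ hb)
    obtain ⟨c, hcX, hce, hcf, hca, hcb⟩ := hc
    have hab : a ≠ b := by rintro rfl; exact hb1 ha1
    have hea : e ≠ a := by rintro rfl; exact ha heL
    have hfa : f ≠ a := by rintro rfl; exact ha hfL
    have heb : e ≠ b := by rintro rfl; exact he hb
    have hfb : f ≠ b := by rintro rfl; exact hf hb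
    have hcard : ({c, e, f, a, b} : Finset (Fin q)).card = 5 := by
      simp [Finset.card_insert_of_notMem, *]
    rw [← hcard]
    refine Finset.card_le_card fun g hg => ?_
    simp only [Finset.mem_insert, Finset.mem_singleton] at hg
    rcases hg with rfl | rfl | rfl | rfl | rfl
    · exact hcX
    · simp [mem_cut, heX, heX']
    · simp [mem_cut, hfX, hfX']
    · simp [mem_cut, ha1, ha2]
    · simp only [not_not] at hb2
      simp [mem_cut, hb1, hb2]
  · refine List.isChain_cons_cons.2 ⟨⟨e, rfl, swapTgt_tgt_left _ _ _⟩, ?_⟩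
    refine hL.isChain.imp_of_mem_imp ?_
    rintro _ _ ha - ⟨g, rfl, rfl⟩
    exact ⟨g, rfl, hsame g ha⟩
  · intro g hg
    rw [swapTgt_src]
    by_cases h1 : g = e
    · simp [h1]
    by_cases h2 : g = f
    · rw [h2]
      exact List.mem_cons_of_mem _ hfL
    rw [swapTgt_tgt_of_ne _ h1 h2] at hg
    rcases List.mem_cons.1 hg with hg | hg
    · exact List.mem_cons_of_mem _ (hin g hg)
    · exact List.mem_cons_of_mem _ (hL.src_mem g hg)
  · intro F hF
    refine Or.inr ⟨le_of_reflTransGen hchain ?_, ?_⟩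
    · rintro _ _ ⟨g, rfl, rfl, hg⟩
      rw [hF (D.tgt g)]
      refine le_add_left ?_
      exact Finset.single_le_sum (f := fun e => F (D.src e)) (fun _ _ => Nat.zero_le _)
        (by simp [hsame g hg])
    · refine le_of_reflTransGen (F := fun v => D.mu v t) (Relation.ReflTransGen.swap _ _ hpath) ?_
      rintro _ _ ⟨g, rfl, rfl, -⟩
      exact hr.mu_tgt_le_mu_src h.uniqueSink.1 g

/-- If a vertex `w` outside the chain has a single edge coming in, and it comes from a vertex of
the chain other than the last one, then `w` can be inserted into the chain after an exchange of
targets. -/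
theorem IsCubicNetwork.swapTgt_insert {D : Multigraph m q} {s t : Fin m}
    (h : D.IsCubicNetwork s t) {A B : List (Fin m)} {e f f' : Fin q}
    (hL : D.IsInitialChain (A ++ D.tgt f :: D.src f :: B)) (hs : s ≠ D.src e)
    (he : D.src e ∉ A ++ D.tgt f :: D.src f :: B)
    (hsrc : D.src f' = D.src f) (hin : ∀ g, D.tgt g = D.src e ↔ g = f')
    (hcut : (D.swapTgt e f).CutBound) :
    (D.swapTgt e f).IsCubicNetwork s t ∧
      (D.swapTgt e f).IsInitialChain (A ++ D.tgt f :: D.src e :: D.src f :: B) ∧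
      D.mu s t ≤ (D.swapTgt e f).mu s t := by
  classical
  obtain ⟨r, hr⟩ := h.acyclic.exists_isRank
  have hnd := hr.nodup_of_isChain hL.isChain
  set P := A ++ D.tgt f :: D.src f :: B with hP
  have hfP : D.src f ∈ P := by simp [hP]
  have hfP' : D.tgt f ∈ P := by simp [hP]
  have heP : D.tgt e ∉ P := fun hh => he (hL.src_mem _ hh)
  have hee : D.tgt e ≠ D.src e := fun hh => (hr e).ne (congrArg r hh.symm)
  have hef : e ≠ f := by rintro rfl; exact he hfP
  have hf' : D.tgt f' = D.src e := (hin f').2 rfl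
  have hf'e : f' ≠ e := by rintro rfl; exact hee hf'
  have hf'f : f' ≠ f := by rintro rfl; exact he (hf' ▸ hfP')
  have hr' : (D.swapTgt e f).IsRank fun v => if v ∈ P then 2 * r v else
      if v = D.src e then 2 * r (D.src f) + 1 else 2 * r v + (2 * r (D.src f) + 2) := by
    intro g
    rw [swapTgt_src]
    beta_reduce
    by_cases h1 : g = e
    · subst h1
      rw [swapTgt_tgt_left, if_pos hfP', if_neg he, if_pos rfl]
      have := hr f
      omega
    by_cases h2 : g = f
    · subst h2
      rw [swapTgt_tgt_right, if_pos hfP, if_neg heP, if_neg hee]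
      omega
    rw [swapTgt_tgt_of_ne _ h1 h2]
    have h3 := hr g
    have h4 := hL.src_mem g
    by_cases h5 : D.tgt g = D.src e
    · obtain rfl := (hin g).1 h5
      rw [hsrc, if_pos hfP, h5, if_neg he, if_pos rfl]
      omega
    · rw [if_neg h5]
      split_ifs <;> first | omega | tauto
  refine ⟨h.swapTgt hr' hcut, ⟨?_, ?_⟩, mu_le_mu_swapTgt hr hef hr' h.uniqueSink.1 ?_⟩
  · have hc := hL.isChain
    rw [hP, List.isChain_append_cons_cons] at hc
    have hfA : ∀ b ∈ A ++ [D.tgt f], b ≠ D.src f ∧ b ∈ P := by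
      rintro b hb
      refine ⟨?_, by simp [hP] at hb ⊢; tauto⟩
      rintro rfl
      rw [hP, List.append_cons] at hnd
      exact (List.nodup_append.1 hnd).2.2 _ hb _ List.mem_cons_self rfl
    have hfB : ∀ b ∈ D.src f :: B, b ≠ D.tgt f ∧ b ∈ P := by
      rintro b hb
      refine ⟨?_, by simp [hP] at hb ⊢; tauto⟩
      rintro rfl
      exact (List.nodup_cons.1 (List.nodup_append.1 hnd).2.1).1 hb
    rw [List.isChain_append_cons_cons, List.isChain_cons_cons]
    refine ⟨hc.1.imp_of_mem_imp ?_, ⟨e, rfl, swapTgt_tgt_left _ _ _⟩, ⟨f', hsrc, ?_⟩,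
      hc.2.2.imp_of_mem_imp ?_⟩
    · rintro _ _ ha hb ⟨g, rfl, rfl⟩
      refine ⟨g, rfl, swapTgt_tgt_of_ne _ ?_ ?_⟩
      · rintro rfl; exact heP (hfA _ ha).2
      · rintro rfl; exact (hfA _ hb).1 rfl
    · rw [swapTgt_tgt_of_ne _ hf'e hf'f, hf']
    · rintro _ _ ha hb ⟨g, rfl, rfl⟩
      refine ⟨g, rfl, swapTgt_tgt_of_ne _ ?_ ?_⟩
      · rintro rfl; exact heP (hfB _ ha).2
      · rintro rfl; exact (hfB _ ha).1 rfl
  · have hmem : ∀ b, b ∈ A ++ D.tgt f :: D.src e :: D.src f :: B ↔ b = D.src e ∨ b ∈ P := by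
      intro b
      simp only [hP, List.mem_append, List.mem_cons]
      tauto
    simp only [hmem, swapTgt_src]
    intro g hg
    by_cases h1 : g = e
    · exact Or.inl (h1 ▸ rfl)
    by_cases h2 : g = f
    · exact Or.inr (h2 ▸ hfP)
    rw [swapTgt_tgt_of_ne _ h1 h2] at hg
    rcases hg with hg | hg
    · rw [(hin g).1 hg, hsrc]
      exact Or.inr hfP
    · exact Or.inr (hL.src_mem g hg)
  · intro F hF
    refine Or.inl ?_
    have hfilter : Finset.univ.filter (fun g => (D.swapTgt e f).tgt g = D.src e) = {f'} := by
      ext g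
      simp only [Finset.mem_filter, Finset.mem_univ, true_and, Finset.mem_singleton]
      by_cases h1 : g = e
      · subst h1
        rw [swapTgt_tgt_left]
        exact iff_of_false (fun hh => he (hh ▸ hfP')) hf'e.symm
      by_cases h2 : g = f
      · subst h2
        rw [swapTgt_tgt_right]
        exact iff_of_false hee hf'f.symm
      rw [swapTgt_tgt_of_ne _ h1 h2, hin]
    rw [hF (D.src e), if_neg hs.symm, hfilter, Finset.sum_singleton, hsrc, zero_add]

theorem CutBound.swapTgt_or {D : Multigraph m q} (hD : D.CutBound) {w : Fin m}
    {e₁ e₂ f f' : Fin q} (hne : e₁ ≠ e₂) (hout : ∀ g, D.src g = w ↔ g = e₁ ∨ g = e₂)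
    (hin : ∀ g, D.tgt g = w ↔ g = f') (hsrc : D.src f' = D.src f) (hfw : D.src f ≠ w)
    (hfw' : D.tgt f ≠ w) :
    (D.swapTgt e₁ f).CutBound ∨ (D.swapTgt e₂ f).CutBound := by
  classical
  have hs₁ : D.src e₁ = w := (hout _).2 (Or.inl rfl)
  have hs₂ : D.src e₂ = w := (hout _).2 (Or.inr rfl)
  have hf' : D.tgt f' = w := (hin _).2 rfl
  by_contra! hcon
  obtain ⟨X, hX1, hX2, hX3, hX4, hX⟩ : ∃ X : Finset (Fin m), D.src e₁ ∈ X ∧ D.tgt f ∈ X ∧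
      D.src f ∉ X ∧ D.tgt e₁ ∉ X ∧ (D.cut X).card < 5 := by
    by_contra! hh
    exact hcon.1 (hD.swapTgt (by rintro rfl; exact hfw hs₁) hh)
  obtain ⟨Y, hY1, hY2, hY3, hY4, hY⟩ : ∃ X : Finset (Fin m), D.src e₂ ∈ X ∧ D.tgt f ∈ X ∧
      D.src f ∉ X ∧ D.tgt e₂ ∉ X ∧ (D.cut X).card < 5 := by
    by_contra! hh
    exact hcon.2 (hD.swapTgt (by rintro rfl; exact hfw hs₂) hh)
  rw [hs₁] at hX1
  rw [hs₂] at hY1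
  have hsub := D.card_cut_inter_add_card_cut_union_le X Y
  have hunion := hD (X ∪ Y) w (D.src f) (by simp [hX1]) (by simp [hX3, hY3])
  have hinter := hD ((X ∩ Y).erase w) (D.tgt f) (D.src f) (by simp [hX2, hY2, hfw'])
    (by simp [hX3])
  have hf₁ : e₁ ≠ f' := by rintro rfl; exact hfw (hsrc ▸ hs₁)
  have hf₂ : e₂ ≠ f' := by rintro rfl; exact hfw (hsrc ▸ hs₂)
  have hdisj : Disjoint {e₁, e₂, f'} (D.cut ((X ∩ Y).erase w)) := by
    simp [Finset.disjoint_left, mem_cut, hs₁, hs₂, hf', hsrc, hX3, hX4, hY4]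
  have hcard : ({e₁, e₂, f'} : Finset (Fin q)).card = 3 :=
    Finset.card_eq_three.2 ⟨_, _, _, hne, hf₁, hf₂, rfl⟩
  have hle : {e₁, e₂, f'} ∪ D.cut ((X ∩ Y).erase w) ⊆ D.cut (X ∩ Y) := by
    intro g hg
    by_cases h1 : g = e₁
    · simp [h1, mem_cut, hs₁, hX1, hY1, hX4]
    by_cases h2 : g = e₂
    · simp [h2, mem_cut, hs₂, hX1, hY1, hY4]
    by_cases h3 : g = f'
    · simp [h3, mem_cut, hf', hsrc, hX1, hY1, hX3]
    have h4 : D.src g ≠ w := by rw [Ne, hout]; tauto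
    have h5 : D.tgt g ≠ w := by rw [Ne, hin]; exact h3
    simpa [h1, h2, h3, h4, h5, mem_cut] using hg
  have := Finset.card_le_card hle
  rw [Finset.card_union_of_disjoint hdisj, hcard] at this
  omega

theorem IsCubicNetwork.exists_longer {D : Multigraph m q} {s t : Fin m}
    (h : D.IsCubicNetwork s t) {L : List (Fin m)} (hL : D.IsInitialChain L) (hs : s ∈ L)
    {v : Fin m} (hv : v ∉ L) :
    ∃ (D' : Multigraph m q) (L' : List (Fin m)), D'.IsCubicNetwork s t ∧ D'.IsInitialChain L' ∧
      s ∈ L' ∧ L'.length = L.length + 1 ∧ D.mu s t ≤ D'.mu s t := by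
  classical
  obtain ⟨r, hr⟩ := h.acyclic.exists_isRank
  obtain _ | ⟨u, L⟩ := L
  · simp at hs
  have hout : D.outdeg u ≠ 0 := by
    intro hu
    obtain rfl := h.uniqueSink.2 u hu
    obtain ⟨x, hx, hmax⟩ := Finset.exists_max_image
      (Finset.univ.filter fun x => x ∉ u :: L) r ⟨v, by simpa using hv⟩
    simp only [Finset.mem_filter, Finset.mem_univ, true_and] at hx hmax
    have hxo : D.outdeg x ≠ 0 := fun hh => hx (h.uniqueSink.2 x hh ▸ List.mem_cons_self)
    obtain ⟨g, hg⟩ := Finset.card_pos.1 (Nat.pos_of_ne_zero hxo)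
    obtain rfl := (Finset.mem_filter.1 hg).2
    refine hx (hL.src_mem g ?_)
    by_contra hh
    exact (hr g).not_ge (hmax _ hh)
  obtain ⟨e, he⟩ := Finset.card_pos.1 (Nat.pos_of_ne_zero hout)
  obtain rfl := (Finset.mem_filter.1 he).2
  clear he hout
  have he : D.tgt e ∉ D.src e :: L := by
    intro hh
    refine (hr e).not_ge (le_of_reflTransGen (reflTransGen_of_isChain_cons hL.isChain hh) ?_)
    rintro _ _ ⟨g, rfl, rfl, -⟩
    exact (hr g).le
  obtain ⟨w, hw, hin, hpath⟩ := hr.exists_minimal _ he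
  by_cases hadj : ∃ g, D.src g = D.src e ∧ D.tgt g = w
  · refine ⟨D, w :: D.src e :: L, h, ⟨List.isChain_cons_cons.2 ⟨hadj, hL.isChain⟩, ?_⟩,
      List.mem_cons_of_mem _ hs, rfl, le_rfl⟩
    intro g hg
    rcases List.mem_cons.1 hg with hg | hg
    · exact List.mem_cons_of_mem _ (hin g hg)
    · exact List.mem_cons_of_mem _ (hL.src_mem g hg)
  push Not at hadj
  have hws : w ≠ s := by rintro rfl; exact hw hs
  obtain ⟨f', hf'⟩ := Finset.card_pos.1
    (Nat.pos_of_ne_zero fun hh : D.indeg w = 0 => hws (h.uniqueSource.2 w hh))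
  obtain rfl := (Finset.mem_filter.1 hf').2
  clear hf'
  by_cases htwo : ∃ f, D.tgt f = D.tgt f' ∧ f ≠ f'
  · obtain ⟨f, hf, hne⟩ := htwo
    rcases reflTransGen_or_of_isChain hL.isChain (hin f hf) (hin f' rfl) with hord | hord
    · obtain ⟨h1, h2, h3⟩ := h.exists_cons_of_two_edges hL he hw hin hadj hf hne hpath hord
      exact ⟨_, _, h1, h2, List.mem_cons_of_mem _ hs, rfl, h3⟩
    · rw [← hf] at hw hin hadj hpath
      obtain ⟨h1, h2, h3⟩ :=
        h.exists_cons_of_two_edges hL he hw hin hadj hf.symm hne.symm hpath hord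
      exact ⟨_, _, h1, h2, List.mem_cons_of_mem _ hs, rfl, h3⟩
  push Not at htwo
  have hin' : ∀ g, D.tgt g = D.tgt f' ↔ g = f' := fun g => ⟨htwo g, fun hh => hh ▸ rfl⟩
  have hindeg : D.indeg (D.tgt f') = 1 :=
    Finset.card_eq_one.2 ⟨f', by ext; simp [hin']⟩
  have houtdeg : D.outdeg (D.tgt f') = 2 := by
    have := h.threeRegular (D.tgt f')
    omega
  obtain ⟨e₁, e₂, hne, hout⟩ := Finset.card_eq_two.1 houtdeg
  replace hout : ∀ g, D.src g = D.tgt f' ↔ g = e₁ ∨ g = e₂ := fun g => by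
    simpa using Finset.ext_iff.1 hout g
  obtain ⟨A, B, hAB⟩ := List.append_of_mem (hin f' rfl)
  obtain ⟨A, v', rfl⟩ : ∃ A' v', A = A' ++ [v'] := by
    rcases List.eq_nil_or_concat A with rfl | ⟨A', v', rfl⟩
    · exact absurd rfl (hadj f' (List.cons.inj hAB).1.symm)
    · exact ⟨A', v', by simp⟩
  rw [List.append_assoc, List.singleton_append] at hAB
  rw [hAB] at hL hs hw ⊢
  obtain ⟨f, hfs, rfl⟩ := (List.isChain_append_cons_cons.1 hL.isChain).2.1
  rw [← hfs] at hL hs hw ⊢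
  have key : ∀ e, D.src e = D.tgt f' → (D.swapTgt e f).CutBound →
      ∃ (D' : Multigraph m q) (L' : List (Fin m)), D'.IsCubicNetwork s t ∧ D'.IsInitialChain L' ∧
      s ∈ L' ∧ L'.length = (A ++ D.tgt f :: D.src f :: B).length + 1 ∧
      D.mu s t ≤ D'.mu s t := by
    intro e he hcut
    rw [← he] at hin' hws hw
    obtain ⟨h1, h2, h3⟩ := h.swapTgt_insert hL hws.symm hw hfs.symm hin' hcut
    refine ⟨_, _, h1, h2, ?_, ?_, h3⟩
    · simp only [List.mem_append, List.mem_cons] at hs ⊢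
      tauto
    · simp only [List.length_append, List.length_cons]
      omega
  rcases h.cutBound.swapTgt_or hne hout hin' hfs.symm
    (fun hh => hw (hh ▸ by simp)) (fun hh => hw (hh ▸ by simp)) with hcut | hcut
  · exact key e₁ ((hout _).2 (Or.inl rfl)) hcut
  · exact key e₂ ((hout _).2 (Or.inr rfl)) hcut

theorem IsCubicNetwork.exists_forall_mem {D : Multigraph m q} {s t : Fin m}
    (h : D.IsCubicNetwork s t) {L : List (Fin m)} (hL : D.IsInitialChain L) (hs : s ∈ L) :
    ∃ (D' : Multigraph m q) (L' : List (Fin m)), D'.IsCubicNetwork s t ∧ D'.IsInitialChain L' ∧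
      (∀ v, v ∈ L') ∧ D.mu s t ≤ D'.mu s t := by
  induction hk : m - L.length generalizing D L with
  | zero =>
    refine ⟨D, L, h, hL, fun v => ?_, le_rfl⟩
    obtain ⟨r, hr⟩ := h.acyclic.exists_isRank
    by_contra hv
    have := (List.nodup_cons.2 ⟨hv, hr.nodup_of_isChain hL.isChain⟩).length_le_card
    simp only [List.length_cons, Fintype.card_fin] at this
    omega
  | succ k ih =>
    by_cases hall : ∀ v, v ∈ L
    · exact ⟨D, L, h, hL, hall, le_rfl⟩
    push Not at hall
    obtain ⟨v, hv⟩ := hall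
    obtain ⟨D₁, L₁, h₁, hL₁, hs₁, hlen, hmu⟩ := h.exists_longer hL hs hv
    obtain ⟨D', L', h', hL', hall, hmu'⟩ := ih h₁ hL₁ hs₁ (by omega)
    exact ⟨D', L', h', hL', hall, hmu.trans hmu'⟩

end Multigraph

/-- Every 3-edge connected, 3-regular acyclic finite directed multigraph on
`2n` vertices with a unique source and unique sink is dominated (in source-to-sink path
count) by a 3-edge connected one with a directed Hamiltonian path. -/
theorem exists_hamiltonian_dominating_threeEdgeConnected (n q : ℕ) (D : Multigraph (2 * n) q)
    (s t : Fin (2 * n)) (hconn : D.EdgeConnected 3) (hreg : D.ThreeRegular)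
    (hacy : D.Acyclic) (hs : D.UniqueSource s) (ht : D.UniqueSink t) :
    ∃ (q' : ℕ) (D' : Multigraph (2 * n) q') (s' t' : Fin (2 * n)),
      D'.EdgeConnected 3 ∧ D'.ThreeRegular ∧ D'.Acyclic ∧ D'.UniqueSource s' ∧
      D'.UniqueSink t' ∧ D'.HasHamiltonianPath ∧ D.mu s t ≤ D'.mu s' t' := by
  obtain ⟨hn, hcut⟩ := (D.edgeConnected_three_iff).1 hconn
  have hL : D.IsInitialChain [s] := by
    refine ⟨List.isChain_singleton _, fun e he => ?_⟩
    exact absurd (List.mem_singleton.1 he) (Multigraph.tgt_ne_of_indeg_eq_zero hs.1 e)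
  obtain ⟨D', L, h', hL', hall, hmu⟩ :=
    Multigraph.IsCubicNetwork.exists_forall_mem ⟨hcut, hreg, hacy, hs, ht⟩ hL
      (List.mem_singleton_self s)
  obtain ⟨r, hr⟩ := h'.acyclic.exists_isRank
  exact ⟨q, D', s, t, D'.edgeConnected_three_iff.2 ⟨hn, h'.cutBound⟩, h'.threeRegular, h'.acyclic,
    h'.uniqueSource, h'.uniqueSink, hr.hasHamiltonianPath hn hL'.isChain hall, hmu⟩
end

section
/- Let D be a 3-regular Hamiltonian-path digraph on {1, …, m} with m ≥ 2. Then D is NOT 3-edge connected if and only if at least one of the following holds: (i) there exists k with 1 ≤ k < m such that #{v ∈ {1,…,k} : indeg(v) = 2} > #{v ∈ {1,…,k} : outdeg(v) = 2}; or (ii) there exist i, j with 1 < i ≤ j < m such that the only edges of D having exactly one endpoint in the interval {i, …, j} are the two designated edges h_{i−1} and h_j. -/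
namespace Multigraph

variable {m q : ℕ}

theorem Adj.symm {D : Multigraph m q} {S : Set (Fin q)} {a b : Fin m} (h : D.Adj S a b) :
    D.Adj S b a := by
  obtain ⟨e, he, h | h⟩ := h
  · exact ⟨e, he, Or.inr h⟩
  · exact ⟨e, he, Or.inl h⟩

/-- A vertex set whose boundary avoids `S` is closed under walks using edges of `S`. -/
theorem mem_iff_of_reflTransGen {D : Multigraph m q} {S : Set (Fin q)} {P : Fin m → Prop}
    (hP : ∀ e ∈ S, P (D.src e) ↔ P (D.tgt e)) {a b : Fin m}
    (h : Relation.ReflTransGen (D.Adj S) a b) : P a ↔ P b := by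
  induction h with
  | refl => rfl
  | tail _ hbc ih =>
    obtain ⟨e, he, ⟨rfl, rfl⟩ | ⟨rfl, rfl⟩⟩ := hbc
    · exact ih.trans (hP e he)
    · exact ih.trans (hP e he).symm

/-- If at most `ℓ - 1` edges contain the boundary of a vertex set separating `a` from `b`,
then the multigraph is not `ℓ`-edge connected. -/
theorem not_edgeConnected_of_boundary {D : Multigraph m q} {ℓ : ℕ} (F : Finset (Fin q))
    (hF : F.card ≤ ℓ - 1) (P : Fin m → Prop)
    (hP : ∀ e, e ∉ F → (P (D.src e) ↔ P (D.tgt e))) {a b : Fin m} (ha : ¬ P a) (hb : P b) :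
    ¬ D.EdgeConnected ℓ := by
  intro h
  have hab : a ≠ b := by rintro rfl; exact ha hb
  exact ha ((mem_iff_of_reflTransGen hP (h.2 F hF a b hab)).2 hb)

/-- If a multigraph is not `ℓ`-edge connected, then for every vertex `r` some nonempty vertex set
avoiding `r` has its boundary contained in a set of at most `ℓ - 1` edges. -/
theorem exists_boundary_of_not_edgeConnected {D : Multigraph m q} {ℓ : ℕ} (hm : 2 ≤ m)
    (h : ¬ D.EdgeConnected ℓ) (r : Fin m) :
    ∃ (F : Finset (Fin q)) (P : Fin m → Prop), F.card ≤ ℓ - 1 ∧ ¬ P r ∧ (∃ v, P v) ∧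
      ∀ e, e ∉ F → (P (D.src e) ↔ P (D.tgt e)) := by
  simp only [EdgeConnected, hm, true_and, not_forall] at h
  obtain ⟨F, hF, hconn⟩ := h
  refine ⟨F, fun v => ¬ Relation.ReflTransGen (D.Adj {e | e ∉ F}) r v, hF,
    not_not.2 .refl, ?_, ?_⟩
  · by_contra! hall
    refine hconn fun a b _ => ?_
    have : Std.Symm (D.Adj {e | e ∉ F}) := ⟨fun _ _ => Adj.symm⟩
    exact (Relation.ReflTransGen.stdSymm.symm _ _ (hall a)).trans (hall b)
  · intro e he
    refine not_congr ⟨fun h => h.tail ⟨e, he, Or.inl ⟨rfl, rfl⟩⟩,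
      fun h => h.tail ⟨e, he, Or.inr ⟨rfl, rfl⟩⟩⟩

theorem sum_outdeg_lt (D : Multigraph m q) (k : ℕ) :
    ∑ v : Fin m with v.val < k, D.outdeg v
      = (Finset.univ.filter fun e => (D.src e).val < k).card := by
  rw [Finset.card_eq_sum_card_fiberwise (f := D.src)
    (t := Finset.univ.filter fun v : Fin m => v.val < k) (by intro e; simp)]
  refine Finset.sum_congr rfl fun v hv => ?_
  rw [outdeg, Finset.filter_filter]
  congr 1
  ext e
  simp only [Finset.mem_filter, Finset.mem_univ, true_and] at hv ⊢
  exact ⟨fun h => ⟨h ▸ hv, h⟩, fun h => h.2⟩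

theorem sum_indeg_lt (D : Multigraph m q) (k : ℕ) :
    ∑ v : Fin m with v.val < k, D.indeg v
      = (Finset.univ.filter fun e => (D.tgt e).val < k).card :=
  sum_outdeg_lt ⟨D.tgt, D.src⟩ k

/-- When all edges increase, the out-degrees of an initial segment exceed its in-degrees by the
number of edges leaving it. -/
theorem sum_outdeg_eq_sum_indeg_add_card_cut {D : Multigraph m q}
    (hlt : ∀ e, (D.src e).val < (D.tgt e).val) (k : ℕ) :
    ∑ v : Fin m with v.val < k, D.outdeg v
      = ∑ v : Fin m with v.val < k, D.indeg v
        + (Finset.univ.filter fun e => (D.src e).val < k ∧ k ≤ (D.tgt e).val).card := by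
  rw [sum_outdeg_lt, sum_indeg_lt, ← Finset.card_union_of_disjoint]
  · congr 1
    ext e
    have := hlt e
    simp only [Finset.mem_filter, Finset.mem_union, Finset.mem_univ, true_and]
    omega
  · rw [Finset.disjoint_filter]
    intro e _ h
    omega

namespace IsHamPathDigraph

variable {D : Multigraph m q} {H : Fin (m - 1) → Fin q}

theorem outdeg_pos (hD : D.IsHamPathDigraph H) {v : Fin m} (hv : v.val < m - 1) :
    0 < D.outdeg v :=
  Finset.card_pos.2 ⟨H ⟨v.val, hv⟩, by
    simpa using Fin.ext (hD.2.1 ⟨v.val, hv⟩).1⟩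

theorem indeg_pos (hD : D.IsHamPathDigraph H) {v : Fin m} (hv : v.val ≠ 0) :
    0 < D.indeg v := by
  have hlt : v.val - 1 < m - 1 := by omega
  refine Finset.card_pos.2 ⟨H ⟨v.val - 1, hlt⟩, ?_⟩
  have := (hD.2.1 ⟨v.val - 1, hlt⟩).2
  simp only [Finset.mem_filter, Finset.mem_univ, true_and, Fin.ext_iff] at this ⊢
  omega

theorem indeg_eq_zero (hD : D.IsHamPathDigraph H) {v : Fin m} (hv : v.val = 0) :
    D.indeg v = 0 := by
  refine Finset.card_eq_zero.2 (Finset.filter_eq_empty_iff.2 ?_)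
  rintro e _ rfl
  have := hD.2.2 e
  omega

/-- The number of edges leaving a proper initial segment of a 3-regular Hamiltonian-path digraph,
in terms of the numbers of vertices of in-degree two and out-degree two in that segment. -/
theorem card_cut_add (hD : D.IsHamPathDigraph H) (hreg : D.ThreeRegular) {k : ℕ} (hk : 1 ≤ k)
    (hkm : k < m) :
    (Finset.univ.filter fun e => (D.src e).val < k ∧ k ≤ (D.tgt e).val).card
        + (Finset.univ.filter fun v : Fin m => v.val < k ∧ D.indeg v = 2).card
      = 3 + (Finset.univ.filter fun v : Fin m => v.val < k ∧ D.outdeg v = 2).card := by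
  have hcut := sum_outdeg_eq_sum_indeg_add_card_cut hD.2.2 k
  have hpt : ∑ v : Fin m with v.val < k, (D.outdeg v + if D.indeg v = 2 then 1 else 0)
      = ∑ v : Fin m with v.val < k, (D.indeg v + (if D.outdeg v = 2 then 1 else 0)
          + if v = ⟨0, by omega⟩ then 3 else 0) := by
    refine Finset.sum_congr rfl fun v hv => ?_
    have hv' : v.val < k := by simpa using hv
    have hr := hreg v
    have ho := hD.outdeg_pos (v := v) (by omega)
    by_cases h0 : v.val = 0
    · have := hD.indeg_eq_zero h0
      rw [if_pos (Fin.ext h0 : v = ⟨0, by omega⟩)]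
      split_ifs <;> omega
    · have := hD.indeg_pos h0
      rw [if_neg (fun h : v = ⟨0, by omega⟩ => h0 (congrArg Fin.val h))]
      split_ifs <;> omega
  rw [Finset.sum_add_distrib, Finset.sum_add_distrib, Finset.sum_add_distrib,
    ← Finset.card_filter, ← Finset.card_filter, Finset.filter_filter, Finset.filter_filter,
    Finset.sum_ite_eq', if_pos (by simpa using Nat.lt_of_succ_le hk)] at hpt
  omega

end IsHamPathDigraph

end Multigraph

/-- Characterization of failure of 3-edge connectivity for a 3-regular
Hamiltonian-path digraph on `{1, …, m}` (vertices `1, …, m` are represented 0-based by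
`Fin m`, and the designated edge `h_t : t → t+1` (1-based) is `H ⟨t-1, _⟩`). -/
theorem not_threeEdgeConnected_iff (m q : ℕ) (hm : 2 ≤ m) (D : Multigraph m q)
    (H : Fin (m - 1) → Fin q) (hD : D.IsHamPathDigraph H) (hreg : D.ThreeRegular) :
    ¬ D.EdgeConnected 3 ↔
      ((∃ k : ℕ, 1 ≤ k ∧ k < m ∧
          (Finset.univ.filter (fun v : Fin m => v.val < k ∧ D.outdeg v = 2)).card <
          (Finset.univ.filter (fun v : Fin m => v.val < k ∧ D.indeg v = 2)).card) ∨
        (∃ i j : ℕ, ∃ _ : 1 < i, ∃ _ : i ≤ j, ∃ _ : j < m,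
          ∀ e : Fin q,
            (Xor' (i ≤ (D.src e).val + 1 ∧ (D.src e).val + 1 ≤ j)
                  (i ≤ (D.tgt e).val + 1 ∧ (D.tgt e).val + 1 ≤ j)) ↔
            (e = H ⟨i - 2, by omega⟩ ∨ e = H ⟨j - 1, by omega⟩))) := by
  have hH := hD.2.1
  have hlt := hD.2.2
  constructor
  · intro h
    obtain ⟨F, P, hF, hP0, ⟨w, hw⟩, hP⟩ :=
      Multigraph.exists_boundary_of_not_edgeConnected hm h ⟨0, by omega⟩
    -- `Q` is the separating set viewed inside the natural numbers.
    let Q : ℕ → Prop := fun n => ∃ hn : n < m, P ⟨n, hn⟩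
    have hQv (v : Fin m) : Q v.val ↔ P v := ⟨fun h => h.2, fun h => ⟨v.2, h⟩⟩
    have hQ (e : Fin q) (he : ¬ (Q (D.src e).val ↔ Q (D.tgt e).val)) : e ∈ F := by
      by_contra hne
      exact he ((hQv _).trans ((hP e hne).trans (hQv _).symm))
    have hQstep (n : ℕ) (hn : n < m - 1) (hne : ¬ (Q n ↔ Q (n + 1))) : H ⟨n, hn⟩ ∈ F := by
      apply hQ
      rwa [(hH ⟨n, hn⟩).1, (hH ⟨n, hn⟩).2]
    classical
    have hex : ∃ n, Q n := ⟨w.val, (hQv w).2 hw⟩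
    obtain ⟨a, ha, hamin⟩ : ∃ a, Q a ∧ ∀ n < a, ¬ Q n :=
      ⟨Nat.find hex, Nat.find_spec hex, fun n hn => Nat.find_min hex hn⟩
    have ham : a < m := ha.1
    have ha0 : a ≠ 0 := by
      rintro rfl
      exact hP0 ha.2
    obtain ⟨a, rfl⟩ := Nat.exists_eq_succ_of_ne_zero ha0
    have hHa : H ⟨a, by omega⟩ ∈ F :=
      hQstep a (by omega) fun h => hamin a (by omega) (h.2 ha)
    by_cases hup : ∀ n, a + 1 ≤ n → n < m → Q n
    · left
      refine ⟨a + 1, by omega, ham, ?_⟩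
      have hcut := hD.card_cut_add hreg (k := a + 1) (by omega) ham
      have hle : (Finset.univ.filter fun e =>
          (D.src e).val < a + 1 ∧ a + 1 ≤ (D.tgt e).val).card ≤ F.card := by
        refine Finset.card_le_card fun e he => hQ e fun h => ?_
        simp only [Finset.mem_filter, Finset.mem_univ, true_and] at he
        exact hamin _ he.1 (h.2 (hup _ he.2 (D.tgt e).2))
      omega
    · right
      push Not at hup
      obtain ⟨c, ⟨hac, hcm, hcQ⟩, hcmin⟩ :
          ∃ c, (a + 1 ≤ c ∧ c < m ∧ ¬ Q c) ∧ ∀ n < c, ¬ (a + 1 ≤ n ∧ n < m ∧ ¬ Q n) :=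
        ⟨Nat.find hup, Nat.find_spec hup, fun n hn => Nat.find_min hup hn⟩
      have hac' : a + 1 < c := by
        rcases hac.lt_or_eq with h | rfl
        · exact h
        · exact absurd ha hcQ
      obtain ⟨c, rfl⟩ : ∃ d, c = d + 1 := ⟨c - 1, by omega⟩
      have hcQ' : Q c := by
        by_contra h
        exact hcmin c (by omega) ⟨by omega, by omega, h⟩
      have hHc : H ⟨c, by omega⟩ ∈ F := hQstep c (by omega) fun h => hcQ (h.1 hcQ')
      have hne : H ⟨a, by omega⟩ ≠ H ⟨c, by omega⟩ := fun h => by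
        have := congrArg Fin.val (hD.1 h)
        simp only at this
        omega
      have hFeq : F = {H ⟨a, by omega⟩, H ⟨c, by omega⟩} := by
        refine (Finset.eq_of_subset_of_card_le ?_ ?_).symm
        · intro e he
          rw [Finset.mem_insert, Finset.mem_singleton] at he
          rcases he with rfl | rfl
          · exact hHa
          · exact hHc
        · rw [Finset.card_pair hne]
          exact hF
      have habove (n : ℕ) (hn : c + 1 ≤ n) : n < m → ¬ Q n := by
        induction n, hn using Nat.le_induction with
        | base => exact fun _ => hcQ
        | succ n hn ih =>
          intro hnm hQn
          have hmem := hQstep n (by omega) fun h => ih (by omega) (h.2 hQn)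
          rw [hFeq, Finset.mem_insert, Finset.mem_singleton] at hmem
          rcases hmem with h | h <;>
          · have := congrArg Fin.val (hD.1 h)
            simp only at this
            omega
      have hQiff (v : Fin m) : Q v.val ↔ a + 2 ≤ v.val + 1 ∧ v.val + 1 ≤ c + 1 := by
        constructor
        · intro h
          by_contra hcon
          rcases lt_or_ge v.val (a + 1) with h1 | h1
          · exact hamin _ h1 h
          · exact habove v.val (by omega) v.2 h
        · intro h
          by_contra hcon
          exact hcmin v.val (by omega) ⟨by omega, v.2, hcon⟩
      refine ⟨a + 2, c + 1, by omega, by omega, hcm, fun e => ?_⟩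
      rw [← hQiff, ← hQiff, Xor', xor_iff_not_iff]
      constructor
      · intro he
        have := hQ e he
        rwa [hFeq, Finset.mem_insert, Finset.mem_singleton] at this
      · rintro (rfl | rfl)
        · rw [(hH _).1, (hH _).2]
          exact fun h => hamin a (by omega) (h.2 ha)
        · rw [(hH _).1, (hH _).2]
          exact fun h => hcQ (h.1 hcQ')
  · rintro (⟨k, hk, hkm, hcard⟩ | ⟨i, j, hi, hij, hj, he⟩)
    · have hcut := hD.card_cut_add hreg hk hkm
      refine Multigraph.not_edgeConnected_of_boundary
        (Finset.univ.filter fun e => (D.src e).val < k ∧ k ≤ (D.tgt e).val) (by omega)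
        (fun v => k ≤ v.val) (fun e he => ?_) (a := ⟨0, by omega⟩) (b := ⟨k, hkm⟩)
        (by simp only; omega) le_rfl
      have := hlt e
      simp only [Finset.mem_filter, Finset.mem_univ, true_and] at he
      omega
    · refine Multigraph.not_edgeConnected_of_boundary
        {H ⟨i - 2, by omega⟩, H ⟨j - 1, by omega⟩} Finset.card_le_two
        (fun v => i ≤ v.val + 1 ∧ v.val + 1 ≤ j) (fun e hne => ?_)
        (a := ⟨0, by omega⟩) (b := ⟨i - 1, by omega⟩)
        (by simp only; omega) (by simp only; omega)
      rw [Finset.mem_insert, Finset.mem_singleton, ← he, Xor', xor_iff_not_iff, not_not] at hne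
      exact hne
end
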